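/- arXiv:1707.04951 — 3 statements merged into one kernel-verified Lean document; each statement's English description precedes it below -/
import Mathlib

section
/- Let k > 4 be an integer and let X₁, X₂ ⊆ ℝ³ be the surfaces of Example 1. Then the germs at 0 of X₁ and X₂ are ambient topologically equivalent: there exist open neighborhoods U, V of 0 in ℝ³ and a homeomorphism h : U → V with h(0) = 0 and h(X₁ ∩ U) = X₂ ∩ V. -/
open Set Metric

noncomputable section

/-- The surface `X₁` of Example 1 in `ℝ³` (coordinates `x = p 0`, `y = p 1`, `t = p 2`). -/
def ExampleX1 (k : ℕ) : Set (EuclideanSpace ℝ (Fin 3)) :=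
  {p | ((p 0 ^ 2 - 2 * p 0 * p 2 + p 1 ^ 2) * (p 0 ^ 2 + 2 * p 0 * p 2 + p 1 ^ 2) - p 2 ^ k) *
        ((p 0 - p 2) ^ 2 + (p 1 - p 2 / 2) ^ 2 - p 2 ^ 2 / 16) *
        ((p 0 - p 2) ^ 2 + (p 1 + p 2 / 2) ^ 2 - p 2 ^ 2 / 16) = 0 ∧ 0 ≤ p 2}

/-- The surface `X₂` of Example 1 in `ℝ³`. -/
def ExampleX2 (k : ℕ) : Set (EuclideanSpace ℝ (Fin 3)) :=
  {p | ((p 0 ^ 2 - 2 * p 0 * p 2 + p 1 ^ 2) * (p 0 ^ 2 + 2 * p 0 * p 2 + p 1 ^ 2) - p 2 ^ k) *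
        ((p 0 - p 2) ^ 2 + p 1 ^ 2 - p 2 ^ 2 / 16) *
        ((p 0 + p 2) ^ 2 + p 1 ^ 2 - p 2 ^ 2 / 16) = 0 ∧ 0 ≤ p 2}

/-- The germs at `0` of `X` and `Y` are ambient topologically equivalent: there exist open
neighborhoods `U, V` of `0` and a homeomorphism `h : U → V` (with continuous inverse `g`)
such that `h 0 = 0` and `h (X ∩ U) = Y ∩ V`. -/
def AmbientTopEquiv {n : ℕ} (X Y : Set (EuclideanSpace ℝ (Fin n))) : Prop :=
  ∃ U V : Set (EuclideanSpace ℝ (Fin n)), IsOpen U ∧ IsOpen V ∧ 0 ∈ U ∧ 0 ∈ V ∧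
    ∃ h g : EuclideanSpace ℝ (Fin n) → EuclideanSpace ℝ (Fin n),
      ContinuousOn h U ∧ ContinuousOn g V ∧
      Set.MapsTo h U V ∧ Set.MapsTo g V U ∧
      (∀ x ∈ U, g (h x) = x) ∧ (∀ y ∈ V, h (g y) = y) ∧
      h 0 = 0 ∧ h '' (X ∩ U) = Y ∩ V

/-- The rotation by the angle `θ (N z)` about the centre `c`, for the quadratic form
`N = r X ^ 2 - 2 p X Y - q Y ^ 2` in the coordinates `(X, Y) = z - c`. It preserves `N` when the
matrix `!![p, q; r, -p]` squares to `-1`, that is when `p ^ 2 + q * r = -1`. -/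
def ellipticTwist (c : ℝ × ℝ) (p q r : ℝ) (θ : ℝ → ℝ) (z : ℝ × ℝ) : ℝ × ℝ :=
  let X := z.1 - c.1
  let Y := z.2 - c.2
  let φ := θ (r * X ^ 2 - 2 * p * X * Y - q * Y ^ 2)
  (c.1 + (Real.cos φ * X + Real.sin φ * (p * X + q * Y)),
    c.2 + (Real.cos φ * Y + Real.sin φ * (r * X - p * Y)))

theorem ellipticTwist_neg_apply {c : ℝ × ℝ} {p q r : ℝ} (h : p ^ 2 + q * r = -1) (θ : ℝ → ℝ)
    (z : ℝ × ℝ) : ellipticTwist c p q r (-θ) (ellipticTwist c p q r θ z) = z := by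
  obtain ⟨x, y⟩ := z
  obtain ⟨a, b⟩ := c
  simp only [ellipticTwist, add_sub_cancel_left, Pi.neg_apply]
  set X := x - a with hX
  set Y := y - b with hY
  set φ := θ (r * X ^ 2 - 2 * p * X * Y - q * Y ^ 2) with hφ
  have hcs := Real.sin_sq_add_cos_sq φ
  set C := Real.cos φ
  set S := Real.sin φ
  have hN : r * (C * X + S * (p * X + q * Y)) ^ 2
      - 2 * p * (C * X + S * (p * X + q * Y)) * (C * Y + S * (r * X - p * Y))
      - q * (C * Y + S * (r * X - p * Y)) ^ 2 = r * X ^ 2 - 2 * p * X * Y - q * Y ^ 2 := by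
    linear_combination (r * X ^ 2 - 2 * p * X * Y - q * Y ^ 2) * hcs
      - S ^ 2 * (r * X ^ 2 - 2 * p * X * Y - q * Y ^ 2) * h
  rw [hN, ← hφ, Real.cos_neg, Real.sin_neg]
  ext
  · change a + (C * (C * X + S * (p * X + q * Y)) + -S * (p * (C * X + S * (p * X + q * Y)) +
      q * (C * Y + S * (r * X - p * Y)))) = x
    linear_combination X * hcs - S ^ 2 * X * h + hX
  · change b + (C * (C * Y + S * (r * X - p * Y)) + -S * (r * (C * X + S * (p * X + q * Y)) -
      p * (C * Y + S * (r * X - p * Y)))) = y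
    linear_combination Y * hcs - S ^ 2 * Y * h + hY

theorem continuous_ellipticTwist (c : ℝ × ℝ) (p q r : ℝ) {θ : ℝ → ℝ} (hθ : Continuous θ) :
    Continuous (ellipticTwist c p q r θ) := by
  unfold ellipticTwist
  fun_prop

/-- The elliptic twist as a homeomorphism of the plane. -/
def ellipticTwistHomeomorph (c : ℝ × ℝ) {p q r : ℝ} (h : p ^ 2 + q * r = -1) {θ : ℝ → ℝ}
    (hθ : Continuous θ) : ℝ × ℝ ≃ₜ ℝ × ℝ where
  toFun := ellipticTwist c p q r θ
  invFun := ellipticTwist c p q r (-θ)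
  left_inv := ellipticTwist_neg_apply h θ
  right_inv z := by simpa using ellipticTwist_neg_apply h (-θ) z
  continuous_toFun := continuous_ellipticTwist c p q r hθ
  continuous_invFun := continuous_ellipticTwist c p q r hθ.neg

theorem ellipticTwist_of_angle_eq_zero {c : ℝ × ℝ} {p q r : ℝ} {θ : ℝ → ℝ} {z : ℝ × ℝ}
    (h : θ (r * (z.1 - c.1) ^ 2 - 2 * p * (z.1 - c.1) * (z.2 - c.2) - q * (z.2 - c.2) ^ 2) = 0) :
    ellipticTwist c p q r θ z = z := by
  simp [ellipticTwist, h]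

theorem ellipticTwist_of_angle_eq_pi {c : ℝ × ℝ} {p q r : ℝ} {θ : ℝ → ℝ} {z : ℝ × ℝ}
    (h : θ (r * (z.1 - c.1) ^ 2 - 2 * p * (z.1 - c.1) * (z.2 - c.2) - q * (z.2 - c.2) ^ 2) =
      Real.pi) :
    ellipticTwist c p q r θ z = (2 * c.1 - z.1, 2 * c.2 - z.2) := by
  simp only [ellipticTwist, h, Real.cos_pi, Real.sin_pi]
  ext <;> ring

/-- A continuous function equal to `π` on `(-∞, a]` and to `0` on `[b, ∞)`. -/
def cutoffAngle (a b s : ℝ) : ℝ := Real.pi * max 0 (min 1 ((b - s) / (b - a)))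

theorem continuous_cutoffAngle (a b : ℝ) : Continuous (cutoffAngle a b) := by
  unfold cutoffAngle
  fun_prop

theorem cutoffAngle_eq_pi {a b s : ℝ} (hab : a < b) (h : s ≤ a) :
    cutoffAngle a b s = Real.pi := by
  have : 1 ≤ (b - s) / (b - a) := by
    rw [le_div_iff₀ (by linarith)]
    linarith
  simp [cutoffAngle, min_eq_left this]

theorem cutoffAngle_eq_zero {a b s : ℝ} (hab : a < b) (h : b ≤ s) : cutoffAngle a b s = 0 := by
  have : (b - s) / (b - a) ≤ 0 := div_nonpos_of_nonpos_of_nonneg (by linarith) (by linarith)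
  rw [cutoffAngle, max_eq_left ((min_le_right _ _).trans this), mul_zero]

/-- The union of the circles of radius `1 / 4` centred at `(1, 1 / 2)` and `(1, -1 / 2)`. -/
def circlesRight : Set (ℝ × ℝ) :=
  {z | (z.1 - 1) ^ 2 + (z.2 - 1 / 2) ^ 2 = 1 / 16 ∨ (z.1 - 1) ^ 2 + (z.2 + 1 / 2) ^ 2 = 1 / 16}

/-- The union of the circles of radius `1 / 4` centred at `(1, 0)` and `(-1, 0)`. -/
def circlesBoth : Set (ℝ × ℝ) :=
  {z | (z.1 - 1) ^ 2 + z.2 ^ 2 = 1 / 16 ∨ (z.1 + 1) ^ 2 + z.2 ^ 2 = 1 / 16}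

theorem le_abs_fst_of_mem_circlesRight {z : ℝ × ℝ} (h : z ∈ circlesRight) : 3 / 4 ≤ |z.1| := by
  refine le_trans ?_ (le_abs_self _)
  rcases h with h | h
  · nlinarith [sq_nonneg (z.2 - 1 / 2)]
  · nlinarith [sq_nonneg (z.2 + 1 / 2)]

theorem le_abs_fst_of_mem_circlesBoth {z : ℝ × ℝ} (h : z ∈ circlesBoth) : 3 / 4 ≤ |z.1| := by
  rcases h with h | h
  · exact le_trans (by nlinarith [sq_nonneg z.2]) (le_abs_self _)
  · exact le_trans (by nlinarith [sq_nonneg z.2]) (neg_le_abs _)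

/-- A half-turn exchanging the discs of radius `1 / 4` centred at `(1, -1 / 2)` and `(-1, 0)`. -/
def lowerSwap : ℝ × ℝ ≃ₜ ℝ × ℝ :=
  ellipticTwistHomeomorph (0, -1 / 4) (p := -3 / 4) (q := -3) (r := 25 / 48) (by norm_num)
    (continuous_cutoffAngle (31 / 50) (33 / 50))

/-- A half-turn exchanging the discs of radius `1 / 4` centred at `(1, 1 / 2)` and `(1, 0)`. -/
def rightSwap : ℝ × ℝ ≃ₜ ℝ × ℝ :=
  ellipticTwistHomeomorph (1, 1 / 4) (p := 0) (q := -2 / 3) (r := 3 / 2) (by norm_num)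
    (continuous_cutoffAngle (17 / 100) (1 / 5))

theorem lowerSwap_eq_self {z : ℝ × ℝ}
    (h : 33 / 50 ≤ z.1 ^ 2 / 3 + 3 * (z.2 + 1 / 4 + z.1 / 4) ^ 2) : lowerSwap z = z :=
  ellipticTwist_of_angle_eq_zero (cutoffAngle_eq_zero (by norm_num) (by norm_num; linarith))

theorem lowerSwap_eq_reflect {z : ℝ × ℝ}
    (h : z.1 ^ 2 / 3 + 3 * (z.2 + 1 / 4 + z.1 / 4) ^ 2 ≤ 31 / 50) :
    lowerSwap z = (-z.1, -1 / 2 - z.2) := by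
  refine (ellipticTwist_of_angle_eq_pi
    (cutoffAngle_eq_pi (by norm_num) (by norm_num; linarith))).trans ?_
  ext <;> norm_num

theorem rightSwap_eq_self {z : ℝ × ℝ}
    (h : 1 / 5 ≤ 3 / 2 * (z.1 - 1) ^ 2 + 2 / 3 * (z.2 - 1 / 4) ^ 2) : rightSwap z = z :=
  ellipticTwist_of_angle_eq_zero (cutoffAngle_eq_zero (by norm_num) (by norm_num; linarith))

theorem rightSwap_eq_reflect {z : ℝ × ℝ}
    (h : 3 / 2 * (z.1 - 1) ^ 2 + 2 / 3 * (z.2 - 1 / 4) ^ 2 ≤ 17 / 100) :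
    rightSwap z = (2 - z.1, 1 / 2 - z.2) := by
  refine (ellipticTwist_of_angle_eq_pi
    (cutoffAngle_eq_pi (by norm_num) (by norm_num; linarith))).trans ?_
  ext <;> norm_num

/-- A homeomorphism of the plane carrying `circlesRight` onto `circlesBoth`. -/
def discMove : ℝ × ℝ ≃ₜ ℝ × ℝ := lowerSwap.trans rightSwap

theorem abs_le_of_discMove_ne {z : ℝ × ℝ} (h : discMove z ≠ z) :
    |z.1| ≤ 29 / 20 ∧ |z.2| ≤ 7 / 8 := by
  by_cases h₁ : 33 / 50 ≤ z.1 ^ 2 / 3 + 3 * (z.2 + 1 / 4 + z.1 / 4) ^ 2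
  · by_cases h₂ : 1 / 5 ≤ 3 / 2 * (z.1 - 1) ^ 2 + 2 / 3 * (z.2 - 1 / 4) ^ 2
    · exact absurd (by simp [discMove, lowerSwap_eq_self h₁, rightSwap_eq_self h₂]) h
    · push Not at h₂
      simp only [abs_le]
      refine ⟨⟨?_, ?_⟩, ?_, ?_⟩ <;> nlinarith [sq_nonneg (z.1 - 1), sq_nonneg (z.2 - 1 / 4)]
  · push Not at h₁
    have hx := abs_le_of_sq_le_sq (show z.1 ^ 2 ≤ (29 / 20) ^ 2 by
      nlinarith [sq_nonneg (z.2 + 1 / 4 + z.1 / 4)]) (by norm_num)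
    have hy := abs_le_of_sq_le_sq (show (z.2 + 1 / 4) ^ 2 ≤ (5 / 8) ^ 2 by
      nlinarith [sq_nonneg (25 / 48 * z.1 + 3 / 4 * (z.2 + 1 / 4))]) (by norm_num)
    exact ⟨hx, abs_le.2 ⟨by linarith [(abs_le.1 hy).1], by linarith [(abs_le.1 hy).2]⟩⟩

theorem lowerSwap_of_mem_circle_one_half {z : ℝ × ℝ}
    (h : (z.1 - 1) ^ 2 + (z.2 - 1 / 2) ^ 2 = 1 / 16) : lowerSwap z = z := by
  have hx : 3 / 4 ≤ z.1 := by nlinarith [sq_nonneg (z.2 - 1 / 2)]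
  have hy : 1 / 4 ≤ z.2 := by nlinarith [sq_nonneg (z.1 - 1)]
  exact lowerSwap_eq_self (by nlinarith)

theorem lowerSwap_of_mem_circle_neg_one_half {z : ℝ × ℝ}
    (h : (z.1 - 1) ^ 2 + (z.2 + 1 / 2) ^ 2 = 1 / 16) : lowerSwap z = (-z.1, -1 / 2 - z.2) := by
  refine lowerSwap_eq_reflect ?_
  nlinarith [sq_nonneg (z.2 + 1 / 2 - 5 / 4 * (z.1 - 1)), sq_nonneg (z.1 - 1 - 39 / 250)]

theorem rightSwap_of_mem_circle_one_half {z : ℝ × ℝ}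
    (h : (z.1 - 1) ^ 2 + (z.2 - 1 / 2) ^ 2 = 1 / 16) : rightSwap z = (2 - z.1, 1 / 2 - z.2) := by
  refine rightSwap_eq_reflect ?_
  nlinarith [sq_nonneg (z.2 - 1 / 2 - 1 / 5)]

theorem rightSwap_of_mem_circle_neg_one {z : ℝ × ℝ}
    (h : (z.1 + 1) ^ 2 + z.2 ^ 2 = 1 / 16) : rightSwap z = z :=
  rightSwap_eq_self (by nlinarith [sq_nonneg z.2, sq_nonneg (z.2 - 1 / 4)])

theorem discMove_mem {z : ℝ × ℝ} (h : z ∈ circlesRight) : discMove z ∈ circlesBoth := by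
  rcases h with h | h
  · left
    simp only [discMove, Homeomorph.trans_apply, lowerSwap_of_mem_circle_one_half h,
      rightSwap_of_mem_circle_one_half h]
    linarith
  · right
    rw [discMove, Homeomorph.trans_apply, lowerSwap_of_mem_circle_neg_one_half h,
      rightSwap_of_mem_circle_neg_one (by norm_num; linarith)]
    norm_num
    linarith

theorem discMove_symm_mem {z : ℝ × ℝ} (h : z ∈ circlesBoth) :
    discMove.symm z ∈ circlesRight := by
  rcases h with h | h
  · have hw : (2 - z.1 - 1) ^ 2 + (1 / 2 - z.2 - 1 / 2) ^ 2 = 1 / 16 := by linarith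
    have : discMove (2 - z.1, 1 / 2 - z.2) = z := by
      rw [discMove, Homeomorph.trans_apply, lowerSwap_of_mem_circle_one_half hw,
        rightSwap_of_mem_circle_one_half hw]
      simp
    rw [← this, Homeomorph.symm_apply_apply]
    exact Or.inl hw
  · have hw : (-z.1 - 1) ^ 2 + (-1 / 2 - z.2 + 1 / 2) ^ 2 = 1 / 16 := by linarith
    have : discMove (-z.1, -1 / 2 - z.2) = z := by
      rw [discMove, Homeomorph.trans_apply, lowerSwap_of_mem_circle_neg_one_half hw]
      simp [rightSwap_of_mem_circle_neg_one h]
    rw [← this, Homeomorph.symm_apply_apply]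
    exact Or.inr hw

/-- The half-height, over the abscissa `u`, of a region inside `(u ^ 2 + v ^ 2) ^ 2 - 4 u ^ 2 < s`
that is as high as `7 / 8` away from the neck `u = 0`. -/
def neckHeight (s u : ℝ) : ℝ := min (7 / 8) (7 / 6 * |u| + min (1 / 20) s)

theorem neckHeight_pos {s : ℝ} (hs : 0 < s) (u : ℝ) : 0 < neckHeight s u :=
  lt_min (by norm_num) (add_pos_of_nonneg_of_pos (by positivity) (lt_min (by norm_num) hs))

theorem neckHeight_le (s u : ℝ) : neckHeight s u ≤ 7 / 8 := min_le_left _ _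

theorem neckHeight_of_le {s u : ℝ} (hs : 0 < s) (hu : 3 / 4 ≤ |u|) : neckHeight s u = 7 / 8 :=
  min_eq_left (by linarith [lt_min (by norm_num : (0 : ℝ) < 1 / 20) hs])

theorem continuous_neckHeight : Continuous fun x : ℝ × ℝ ↦ neckHeight x.1 x.2 := by
  unfold neckHeight
  fun_prop

theorem sq_lt_of_abs_le_neckHeight {s u v : ℝ} (hs : 0 < s) (hu : |u| ≤ 29 / 20)
    (hv : |v| ≤ neckHeight s u) : (u ^ 2 + v ^ 2) ^ 2 - 4 * u ^ 2 < s := by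
  obtain ⟨h₁, h₂⟩ := le_min_iff.1 hv
  rw [← sq_abs u, ← sq_abs v]
  have hu0 := abs_nonneg u
  have hv0 := abs_nonneg v
  generalize |u| = a at *
  generalize |v| = b at *
  rcases le_or_gt (3 / 4) a with ha | ha
  · have hb : b ^ 2 ≤ (7 / 8) ^ 2 := pow_le_pow_left₀ hv0 h₁ 2
    have : a ^ 2 + b ^ 2 < 2 * a := by nlinarith
    nlinarith [sq_nonneg a, sq_nonneg b]
  · obtain ⟨he0, he1, hes⟩ : 0 < min (1 / 20) s ∧ min (1 / 20) s ≤ 1 / 20 ∧ min (1 / 20) s ≤ s :=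
      ⟨lt_min (by norm_num) hs, min_le_left _ _, min_le_right _ _⟩
    generalize min (1 / 20) s = e at *
    have hb : b ^ 2 ≤ (7 / 6 * a + e) ^ 2 := pow_le_pow_left₀ hv0 h₂ 2
    have : a ^ 2 + b ^ 2 ≤ 2 * a + e ^ 2 := by nlinarith
    have : (a ^ 2 + b ^ 2) ^ 2 ≤ (2 * a + e ^ 2) ^ 2 := pow_le_pow_left₀ (by positivity) this 2
    have : e ^ 2 ≤ e / 20 := by nlinarith
    nlinarith [sq_nonneg e]

/-- The conjugate of `K` by the vertical stretching that maps the height `neckHeight s` to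
`7 / 8`. -/
def conjStretch (K : ℝ × ℝ → ℝ × ℝ) (s : ℝ) (z : ℝ × ℝ) : ℝ × ℝ :=
  let w := K (z.1, z.2 * (7 / 8) / neckHeight s z.1)
  (w.1, w.2 * neckHeight s w.1 / (7 / 8))

theorem conjStretch_conjStretch {K L : ℝ × ℝ → ℝ × ℝ} (h : ∀ z, L (K z) = z) {s : ℝ}
    (hs : 0 < s) (z : ℝ × ℝ) : conjStretch L s (conjStretch K s z) = z := by
  have hpos := fun u ↦ (neckHeight_pos hs u).ne'
  simp only [conjStretch]
  set w := K (z.1, z.2 * (7 / 8) / neckHeight s z.1) with hw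
  have h₁ : w.2 * neckHeight s w.1 / (7 / 8) * (7 / 8) / neckHeight s w.1 = w.2 := by
    field_simp [hpos w.1]
  rw [h₁, Prod.mk.eta, hw, h]
  ext
  · rfl
  · field_simp [hpos z.1]

theorem continuousOn_conjStretch {K : ℝ × ℝ → ℝ × ℝ} (hK : Continuous K) :
    ContinuousOn (fun x : ℝ × ℝ × ℝ ↦ conjStretch K x.1 x.2) {x | 0 < x.1} := by
  have hc : ContinuousOn (fun x : ℝ × ℝ × ℝ ↦
      K (x.2.1, x.2.2 * (7 / 8) / neckHeight x.1 x.2.1)) {x | 0 < x.1} := by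
    refine hK.comp_continuousOn (ContinuousOn.prodMk (by fun_prop) (ContinuousOn.div (by fun_prop)
      ?_ fun x hx ↦ (neckHeight_pos hx _).ne'))
    exact (continuous_neckHeight.comp (by fun_prop :
      Continuous fun x : ℝ × ℝ × ℝ ↦ (x.1, x.2.1))).continuousOn
  refine hc.fst.prodMk ((hc.snd.mul ?_).div_const _)
  exact continuous_neckHeight.comp_continuousOn (continuousOn_fst.prodMk hc.fst)

section Support

variable {K : ℝ × ℝ → ℝ × ℝ} {s : ℝ} {z : ℝ × ℝ}

theorem abs_le_of_conjStretch_ne (hK : ∀ z, K z ≠ z → |z.1| ≤ 29 / 20 ∧ |z.2| ≤ 7 / 8)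
    (hs : 0 < s) (h : conjStretch K s z ≠ z) : |z.1| ≤ 29 / 20 ∧ |z.2| ≤ neckHeight s z.1 := by
  have hpos := neckHeight_pos hs z.1
  have hne : K (z.1, z.2 * (7 / 8) / neckHeight s z.1) ≠
      (z.1, z.2 * (7 / 8) / neckHeight s z.1) := by
    intro h'
    refine h ?_
    simp only [conjStretch, h']
    ext
    · rfl
    · field_simp
  obtain ⟨h₁, h₂⟩ := hK _ hne
  refine ⟨h₁, ?_⟩
  rw [abs_div, abs_mul, abs_of_pos hpos, abs_of_pos (by norm_num : (0 : ℝ) < 7 / 8),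
    div_le_iff₀ hpos] at h₂
  linarith

theorem conjStretch_ne (hinj : Function.Injective K) (hs : 0 < s) (h : conjStretch K s z ≠ z) :
    conjStretch K s (conjStretch K s z) ≠ conjStretch K s z := by
  intro h'
  have hl := conjStretch_conjStretch (Function.leftInverse_invFun hinj) hs
  exact h (by rw [← hl (conjStretch K s z), h', hl])

theorem abs_conjStretch_sub_le (hinj : Function.Injective K)
    (hK : ∀ z, K z ≠ z → |z.1| ≤ 29 / 20 ∧ |z.2| ≤ 7 / 8) (hs : 0 < s) :
    |(conjStretch K s z).1 - z.1| ≤ 3 ∧ |(conjStretch K s z).2 - z.2| ≤ 3 := by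
  by_cases h : conjStretch K s z = z
  · simp [h]
  obtain ⟨h₁, h₂⟩ := abs_le_of_conjStretch_ne hK hs h
  obtain ⟨h₃, h₄⟩ := abs_le_of_conjStretch_ne hK hs (conjStretch_ne hinj hs h)
  have := neckHeight_le s z.1
  have := neckHeight_le s (conjStretch K s z).1
  exact ⟨(abs_sub _ _).trans (by linarith), (abs_sub _ _).trans (by linarith)⟩

theorem conjStretch_peanut (hK : ∀ z, K z ≠ z → |z.1| ≤ 29 / 20 ∧ |z.2| ≤ 7 / 8) (hs : 0 < s)
    (hz : (z.1 ^ 2 + z.2 ^ 2) ^ 2 - 4 * z.1 ^ 2 = s) : conjStretch K s z = z := by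
  by_contra h
  obtain ⟨h₁, h₂⟩ := abs_le_of_conjStretch_ne hK hs h
  exact (sq_lt_of_abs_le_neckHeight hs h₁ h₂).ne hz

theorem conjStretch_mem {A B : Set (ℝ × ℝ)} (hA : ∀ z ∈ A, 3 / 4 ≤ |z.1|)
    (hB : ∀ z ∈ B, 3 / 4 ≤ |z.1|) (hAB : MapsTo K A B) (hs : 0 < s) (hz : z ∈ A) :
    conjStretch K s z ∈ B := by
  have h₁ : (z.1, z.2 * (7 / 8) / neckHeight s z.1) = z := by
    rw [neckHeight_of_le hs (hA z hz), mul_div_cancel_right₀ _ (by norm_num)]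
  simp only [conjStretch, h₁]
  rw [neckHeight_of_le hs (hB _ (hAB hz)), mul_div_cancel_right₀ _ (by norm_num)]
  exact hAB hz

end Support

/-- The map of `ℝ³` equal to `F t` in the slice at height `t > 0`, in the coordinates
`(x / t, y / t)`, and to the identity below. -/
def coneMap (F : ℝ → ℝ × ℝ → ℝ × ℝ) (p : EuclideanSpace ℝ (Fin 3)) : EuclideanSpace ℝ (Fin 3) :=
  if 0 < p 2 then
    !₂[p 2 * (F (p 2) (p 0 / p 2, p 1 / p 2)).1, p 2 * (F (p 2) (p 0 / p 2, p 1 / p 2)).2, p 2]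
  else p

theorem coneMap_of_pos (F : ℝ → ℝ × ℝ → ℝ × ℝ) {p : EuclideanSpace ℝ (Fin 3)} (hp : 0 < p 2) :
    coneMap F p = !₂[p 2 * (F (p 2) (p 0 / p 2, p 1 / p 2)).1,
      p 2 * (F (p 2) (p 0 / p 2, p 1 / p 2)).2, p 2] := if_pos hp

theorem coneMap_of_nonpos (F : ℝ → ℝ × ℝ → ℝ × ℝ) {p : EuclideanSpace ℝ (Fin 3)}
    (hp : p 2 ≤ 0) : coneMap F p = p := if_neg hp.not_gt

theorem coneMap_coneMap {F G : ℝ → ℝ × ℝ → ℝ × ℝ} (h : ∀ t > 0, ∀ z, G t (F t z) = z)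
    (p : EuclideanSpace ℝ (Fin 3)) : coneMap G (coneMap F p) = p := by
  rcases lt_or_ge 0 (p 2) with hp | hp
  · rw [coneMap_of_pos F hp, coneMap_of_pos G (by simpa using hp)]
    ext i
    fin_cases i <;> simp [mul_div_cancel_left₀ _ hp.ne', h _ hp, mul_div_cancel₀ _ hp.ne']
  · rw [coneMap_of_nonpos F hp, coneMap_of_nonpos G hp]

theorem abs_coneMap_sub_le {F : ℝ → ℝ × ℝ → ℝ × ℝ} {C : ℝ}
    (hC : ∀ t > 0, ∀ z, |(F t z).1 - z.1| ≤ C ∧ |(F t z).2 - z.2| ≤ C)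
    (p : EuclideanSpace ℝ (Fin 3)) (i : Fin 3) : |coneMap F p i - p i| ≤ C * |p 2| := by
  have hC0 : 0 ≤ C := (abs_nonneg _).trans (hC 1 one_pos 0).1
  rcases lt_or_ge 0 (p 2) with hp | hp
  · have key {a b : ℝ} (h : |a - b / p 2| ≤ C) : |p 2 * a - b| ≤ C * |p 2| := by
      rw [show p 2 * a - b = (a - b / p 2) * p 2 by field_simp, abs_mul]
      gcongr
    obtain ⟨h₁, h₂⟩ := hC _ hp (p 0 / p 2, p 1 / p 2)
    rw [coneMap_of_pos F hp]
    fin_cases i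
    · exact key h₁
    · exact key h₂
    · simpa using mul_nonneg hC0 (abs_nonneg _)
  · rw [coneMap_of_nonpos F hp, sub_self, abs_zero]
    positivity

theorem continuous_coneMap {F : ℝ → ℝ × ℝ → ℝ × ℝ} {C : ℝ}
    (hF : ContinuousOn (fun x : ℝ × ℝ × ℝ ↦ F x.1 x.2) {x | 0 < x.1})
    (hC : ∀ t > 0, ∀ z, |(F t z).1 - z.1| ≤ C ∧ |(F t z).2 - z.2| ≤ C) :
    Continuous (coneMap F) := by
  have hcoord (i : Fin 3) : Continuous fun x : EuclideanSpace ℝ (Fin 3) ↦ x i := by fun_prop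
  refine continuous_iff_continuousAt.2 fun p ↦ ?_
  rcases lt_trichotomy (p 2) 0 with hp | hp | hp
  · have : ∀ᶠ x : EuclideanSpace ℝ (Fin 3) in nhds p, x 2 < 0 :=
      (hcoord 2).continuousAt.eventually_lt continuousAt_const hp
    exact continuousAt_id.congr (this.mono fun x hx ↦ (coneMap_of_nonpos F hx.le).symm)
  · refine (PiLp.continuous_toLp 2 _).continuousAt.comp (f := fun x ↦ (coneMap F x).ofLp)
      (continuousAt_pi.2 fun i ↦ ?_)
    have h0 : Filter.Tendsto (fun x ↦ coneMap F x i - x i) (nhds p) (nhds 0) := by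
      refine squeeze_zero_norm (fun x ↦ abs_coneMap_sub_le hC x i) ?_
      have h := (hcoord 2).abs.continuousAt.const_mul C (x := p)
      rwa [ContinuousAt, hp, abs_zero, mul_zero] at h
    have h1 := h0.add (hcoord i).continuousAt
    simpa [ContinuousAt, coneMap_of_nonpos F hp.le] using h1
  · have : ∀ᶠ x : EuclideanSpace ℝ (Fin 3) in nhds p, 0 < x 2 :=
      continuousAt_const.eventually_lt (hcoord 2).continuousAt hp
    have hG : ContinuousAt (fun x : EuclideanSpace ℝ (Fin 3) ↦
        (x 2, x 0 / x 2, x 1 / x 2)) p :=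
      (hcoord 2).continuousAt.prodMk
        (((hcoord 0).continuousAt.div (hcoord 2).continuousAt hp.ne').prodMk
          ((hcoord 1).continuousAt.div (hcoord 2).continuousAt hp.ne'))
    have hFG : ContinuousAt (fun x : EuclideanSpace ℝ (Fin 3) ↦
        F (x 2) (x 0 / x 2, x 1 / x 2)) p :=
      ContinuousAt.comp (g := fun x : ℝ × ℝ × ℝ ↦ F x.1 x.2) (hF.continuousAt
        ((isOpen_lt continuous_const continuous_fst).mem_nhds hp)) hG
    refine ContinuousAt.congr ?_ (this.mono fun x hx ↦ (coneMap_of_pos F hx).symm)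
    refine (PiLp.continuous_toLp 2 _).continuousAt.comp (continuousAt_pi.2 fun i ↦ ?_)
    fin_cases i
    · exact (hcoord 2).continuousAt.mul hFG.fst
    · exact (hcoord 2).continuousAt.mul hFG.snd
    · exact (hcoord 2).continuousAt

theorem mem_ExampleX1_iff (m : ℕ) {p : EuclideanSpace ℝ (Fin 3)} (hp : 0 < p 2) :
    p ∈ ExampleX1 (m + 4) ↔ ((p 0 / p 2) ^ 2 + (p 1 / p 2) ^ 2) ^ 2 - 4 * (p 0 / p 2) ^ 2 = p 2 ^ m
      ∨ (p 0 / p 2, p 1 / p 2) ∈ circlesRight := by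
  simp only [ExampleX1, circlesRight, mem_ofPred_eq, hp.le, and_true]
  generalize p 0 = x, p 1 = y, p 2 = t at *
  have h₁ : (x ^ 2 - 2 * x * t + y ^ 2) * (x ^ 2 + 2 * x * t + y ^ 2) - t ^ (m + 4) =
      t ^ 4 * (((x / t) ^ 2 + (y / t) ^ 2) ^ 2 - 4 * (x / t) ^ 2 - t ^ m) := by
    field_simp
    ring
  have h₂ : (x - t) ^ 2 + (y - t / 2) ^ 2 - t ^ 2 / 16 =
      t ^ 2 * ((x / t - 1) ^ 2 + (y / t - 1 / 2) ^ 2 - 1 / 16) := by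
    field_simp
  have h₃ : (x - t) ^ 2 + (y + t / 2) ^ 2 - t ^ 2 / 16 =
      t ^ 2 * ((x / t - 1) ^ 2 + (y / t + 1 / 2) ^ 2 - 1 / 16) := by
    field_simp
  simp [h₁, h₂, h₃, hp.ne', sub_eq_zero, or_assoc]

theorem mem_ExampleX2_iff (m : ℕ) {p : EuclideanSpace ℝ (Fin 3)} (hp : 0 < p 2) :
    p ∈ ExampleX2 (m + 4) ↔ ((p 0 / p 2) ^ 2 + (p 1 / p 2) ^ 2) ^ 2 - 4 * (p 0 / p 2) ^ 2 = p 2 ^ m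
      ∨ (p 0 / p 2, p 1 / p 2) ∈ circlesBoth := by
  simp only [ExampleX2, circlesBoth, mem_ofPred_eq, hp.le, and_true]
  generalize p 0 = x, p 1 = y, p 2 = t at *
  have h₁ : (x ^ 2 - 2 * x * t + y ^ 2) * (x ^ 2 + 2 * x * t + y ^ 2) - t ^ (m + 4) =
      t ^ 4 * (((x / t) ^ 2 + (y / t) ^ 2) ^ 2 - 4 * (x / t) ^ 2 - t ^ m) := by
    field_simp
    ring
  have h₂ : (x - t) ^ 2 + y ^ 2 - t ^ 2 / 16 =
      t ^ 2 * ((x / t - 1) ^ 2 + (y / t) ^ 2 - 1 / 16) := by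
    field_simp
  have h₃ : (x + t) ^ 2 + y ^ 2 - t ^ 2 / 16 =
      t ^ 2 * ((x / t + 1) ^ 2 + (y / t) ^ 2 - 1 / 16) := by
    field_simp
  simp [h₁, h₂, h₃, hp.ne', sub_eq_zero, or_assoc]

theorem mem_ExampleX1_iff_mem_ExampleX2 (k : ℕ) {p : EuclideanSpace ℝ (Fin 3)} (hp : p 2 ≤ 0) :
    p ∈ ExampleX1 k ↔ p ∈ ExampleX2 k := by
  rcases hp.lt_or_eq with hp | hp
  · simp [ExampleX1, ExampleX2, hp.not_ge]
  · simp [ExampleX1, ExampleX2, hp]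

/-- Theorem 2.1, ambient topological part: for any integer `k > 4`, the
germs at the origin of the surfaces `X₁` and `X₂` of Example 1 are ambient topologically
equivalent. -/
theorem example1_ambient_top_equiv (k : ℕ) (hk : 4 < k) :
    AmbientTopEquiv (ExampleX1 k) (ExampleX2 k) := by
  obtain ⟨m, rfl⟩ := Nat.exists_eq_add_of_le' hk.le
  have hK : ∀ z, discMove z ≠ z → |z.1| ≤ 29 / 20 ∧ |z.2| ≤ 7 / 8 :=
    fun _ ↦ abs_le_of_discMove_ne
  have hK' : ∀ z, discMove.symm z ≠ z → |z.1| ≤ 29 / 20 ∧ |z.2| ≤ 7 / 8 := fun z hz ↦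
    hK z fun h ↦ hz (by rw [Homeomorph.symm_apply_eq, h])
  have hcont (K : ℝ × ℝ ≃ₜ ℝ × ℝ) (hK : ∀ z, K z ≠ z → |z.1| ≤ 29 / 20 ∧ |z.2| ≤ 7 / 8) :
      Continuous (coneMap fun t ↦ conjStretch K (t ^ m)) := by
    refine continuous_coneMap (C := 3) ?_ fun t ht z ↦
      abs_conjStretch_sub_le K.injective hK (pow_pos ht m)
    refine (continuousOn_conjStretch K.continuous).comp
      (f := fun x : ℝ × ℝ × ℝ ↦ (x.1 ^ m, x.2)) (by fun_prop) fun x hx ↦ ?_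
    exact pow_pos (show 0 < x.1 from hx) m
  set h := coneMap fun t ↦ conjStretch discMove (t ^ m) with hh
  set g := coneMap fun t ↦ conjStretch discMove.symm (t ^ m) with hg
  have hgh : ∀ p, g (h p) = p := coneMap_coneMap fun t ht ↦
    conjStretch_conjStretch discMove.symm_apply_apply (pow_pos ht m)
  have hhg : ∀ p, h (g p) = p := coneMap_coneMap fun t ht ↦
    conjStretch_conjStretch discMove.apply_symm_apply (pow_pos ht m)
  have hX (p) (hp : p ∈ ExampleX1 (m + 4)) : h p ∈ ExampleX2 (m + 4) := by
    rcases lt_or_ge 0 (p 2) with h0 | h0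
    · rw [hh, coneMap_of_pos _ h0, mem_ExampleX2_iff m (by simpa using h0)]
      rcases (mem_ExampleX1_iff m h0).1 hp with hp | hp
      · have := conjStretch_peanut hK (pow_pos h0 m)
          (z := (p 0 / p 2, p 1 / p 2)) hp
        left
        simpa [mul_div_cancel_left₀ _ h0.ne', this] using hp
      · right
        simpa [mul_div_cancel_left₀ _ h0.ne'] using
          conjStretch_mem (fun _ ↦ le_abs_fst_of_mem_circlesRight)
            (fun _ ↦ le_abs_fst_of_mem_circlesBoth) (fun _ ↦ discMove_mem) (pow_pos h0 m) hp
    · rwa [hh, coneMap_of_nonpos _ h0, ← mem_ExampleX1_iff_mem_ExampleX2 _ h0]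
  have hY (p) (hp : p ∈ ExampleX2 (m + 4)) : g p ∈ ExampleX1 (m + 4) := by
    rcases lt_or_ge 0 (p 2) with h0 | h0
    · rw [hg, coneMap_of_pos _ h0, mem_ExampleX1_iff m (by simpa using h0)]
      rcases (mem_ExampleX2_iff m h0).1 hp with hp | hp
      · have := conjStretch_peanut hK' (pow_pos h0 m)
          (z := (p 0 / p 2, p 1 / p 2)) hp
        left
        simpa [mul_div_cancel_left₀ _ h0.ne', this] using hp
      · right
        simpa [mul_div_cancel_left₀ _ h0.ne'] using
          conjStretch_mem (fun _ ↦ le_abs_fst_of_mem_circlesBoth)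
            (fun _ ↦ le_abs_fst_of_mem_circlesRight) (fun _ ↦ discMove_symm_mem)
            (pow_pos h0 m) hp
    · rwa [hg, coneMap_of_nonpos _ h0, mem_ExampleX1_iff_mem_ExampleX2 _ h0]
  refine ⟨univ, univ, isOpen_univ, isOpen_univ, mem_univ _, mem_univ _, h, g,
    (hcont discMove hK).continuousOn, (hcont discMove.symm hK').continuousOn,
    mapsTo_univ _ _, mapsTo_univ _ _, fun p _ ↦ hgh p, fun p _ ↦ hhg p,
    coneMap_of_nonpos _ le_rfl, ?_⟩
  rw [inter_univ, inter_univ]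
  exact Subset.antisymm (image_subset_iff.2 hX) fun p hp ↦ ⟨g p, hY p hp, hhg p⟩
end
end

section
/- Let k > 4 be an integer and let X₁, X₂ ⊆ ℝ³ be the surfaces of Example 1. Then the germs at 0 of X₁ and X₂ are NOT ambient Lipschitz equivalent: there do not exist open neighborhoods U, V of 0 in ℝ³ and a homeomorphism h : U → V such that h and h⁻¹ are Lipschitz, h(0) = 0 and h(X₁ ∩ U) = X₂ ∩ V. -/
open Set Metric

noncomputable section

/-- The germs at `0` of `X` and `Y` are ambient Lipschitz equivalent: there exist open
neighborhoods `U, V` of `0` and a homeomorphism `h : U → V` (with inverse `g`) such that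
`h` and `g = h⁻¹` are Lipschitz, `h 0 = 0` and `h (X ∩ U) = Y ∩ V`. -/
def AmbientLipEquiv {n : ℕ} (X Y : Set (EuclideanSpace ℝ (Fin n))) : Prop :=
  ∃ U V : Set (EuclideanSpace ℝ (Fin n)), IsOpen U ∧ IsOpen V ∧ 0 ∈ U ∧ 0 ∈ V ∧
    ∃ h g : EuclideanSpace ℝ (Fin n) → EuclideanSpace ℝ (Fin n),
      Set.MapsTo h U V ∧ Set.MapsTo g V U ∧
      (∀ x ∈ U, g (h x) = x) ∧ (∀ y ∈ V, h (g y) = y) ∧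
      (∃ K : NNReal, LipschitzOnWith K h U ∧ LipschitzOnWith K g V) ∧
      h 0 = 0 ∧ h '' (X ∩ U) = Y ∩ V

open Filter Topology

/-! ### Blow-ups of Lipschitz maps along an ultrafilter -/

section BlowUp

variable {E : Type*} [NormedAddCommGroup E] [NormedSpace ℝ E]

/-- The tangent cone at `0` of `X` along the filter `l` of scales: limits of `s⁻¹ • x s`
with `x s ∈ X`. -/
def tangentConeAlong (l : Filter ℝ) (X : Set E) : Set E :=
  {v | ∃ x : ℝ → E, (∀ᶠ s in l, x s ∈ X) ∧ Tendsto (fun s => s⁻¹ • x s) l (𝓝 v)}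

lemma eventually_pos_of_le {l : Filter ℝ} (hl : l ≤ 𝓝[>] 0) : ∀ᶠ s in l, 0 < s :=
  hl self_mem_nhdsWithin

lemma tendsto_id_of_le {l : Filter ℝ} (hl : l ≤ 𝓝[>] 0) : Tendsto (fun s : ℝ => s) l (𝓝 0) :=
  hl.trans nhdsWithin_le_nhds

lemma tendsto_zero_of_tendsto_inv_smul {l : Filter ℝ} (hl : l ≤ 𝓝[>] 0) {x : ℝ → E} {v : E}
    (hx : Tendsto (fun s => s⁻¹ • x s) l (𝓝 v)) : Tendsto x l (𝓝 0) := by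
  have h := (tendsto_id_of_le hl).smul hx
  rw [zero_smul] at h
  refine h.congr' ?_
  filter_upwards [eventually_pos_of_le hl] with s hs
  rw [smul_inv_smul₀ hs.ne']

lemma tendsto_inv_smul_smul {l : Filter ℝ} (hl : l ≤ 𝓝[>] 0) {q : ℝ → E} {v : E}
    (hq : Tendsto q l (𝓝 v)) : Tendsto (fun s => s⁻¹ • s • q s) l (𝓝 v) := by
  refine hq.congr' ?_
  filter_upwards [eventually_pos_of_le hl] with s hs
  rw [inv_smul_smul₀ hs.ne']

lemma mem_tangentConeAlong_of_smul {l : Filter ℝ} (hl : l ≤ 𝓝[>] 0) {X : Set E} {v : E}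
    (q : ℝ → E) (hq : Tendsto q l (𝓝 v)) (hX : ∀ s, 0 < s → s • q s ∈ X) :
    v ∈ tangentConeAlong l X :=
  ⟨fun s => s • q s, (eventually_pos_of_le hl).mono hX, tendsto_inv_smul_smul hl hq⟩

/-- `H` is a blow-up at `0` of `h` along `l`. -/
def IsBlowUp (l : Filter ℝ) (h H : E → E) : Prop :=
  ∀ (x : ℝ → E) (v : E), Tendsto (fun s => s⁻¹ • x s) l (𝓝 v) →
    Tendsto (fun s => s⁻¹ • h (x s)) l (𝓝 (H v))

lemma exists_isBlowUp [ProperSpace E] {l : Ultrafilter ℝ} (hl : (l : Filter ℝ) ≤ 𝓝[>] 0)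
    {K : NNReal} {h : E → E} {U : Set E} (hU : U ∈ 𝓝 0) (hh : LipschitzOnWith K h U)
    (h0 : h 0 = 0) : ∃ H, IsBlowUp (l : Filter ℝ) h H ∧ Continuous H := by
  have h_dist : ∀ (x y : ℝ → E) (v w : E), Tendsto (fun s => s⁻¹ • x s) l (𝓝 v) →
      Tendsto (fun s => s⁻¹ • y s) l (𝓝 w) →
      ∀ᶠ s in (l : Filter ℝ),
        dist (s⁻¹ • h (x s)) (s⁻¹ • h (y s)) ≤ K * dist (s⁻¹ • x s) (s⁻¹ • y s) := by
    intro x y v w hx hy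
    filter_upwards [eventually_pos_of_le hl, tendsto_zero_of_tendsto_inv_smul hl hx hU,
      tendsto_zero_of_tendsto_inv_smul hl hy hU] with s hs hxs hys
    rw [dist_smul₀, dist_smul₀, ← mul_left_comm]
    exact mul_le_mul_of_nonneg_left (hh.dist_le_mul _ hxs _ hys) (norm_nonneg _)
  have h_const : ∀ v : E, Tendsto (fun s : ℝ => s⁻¹ • s • v) l (𝓝 v) := fun v =>
    tendsto_inv_smul_smul hl tendsto_const_nhds
  have h_lim : ∀ v : E, ∃ w, Tendsto (fun s : ℝ => s⁻¹ • h (s • v)) l (𝓝 w) := by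
    intro v
    have hb : ∀ᶠ s in (l : Filter ℝ), s⁻¹ • h (s • v) ∈ closedBall (0 : E) (K * ‖v‖) := by
      have h_zero : Tendsto (fun s : ℝ => s⁻¹ • (0 : E)) l (𝓝 0) := by simp
      filter_upwards [eventually_pos_of_le hl, h_dist _ (fun _ => 0) v 0 (h_const v) h_zero]
        with s hs hd
      simpa [h0, inv_smul_smul₀ hs.ne'] using hd
    obtain ⟨w, -, hw⟩ := (isCompact_closedBall (0 : E) (K * ‖v‖)).ultrafilter_le_nhds
      (l.map fun s : ℝ => s⁻¹ • h (s • v)) (le_principal_iff.2 hb)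
    exact ⟨w, hw⟩
  choose H hH using h_lim
  refine ⟨H, ?_, ?_⟩
  · intro x v hx
    refine (tendsto_iff_of_dist ?_).1 (hH v)
    have h2 : Tendsto (fun s : ℝ => (K : ℝ) * dist (s⁻¹ • s • v) (s⁻¹ • x s)) l (𝓝 0) := by
      simpa using ((h_const v).dist hx).const_mul (K : ℝ)
    exact squeeze_zero' (Eventually.of_forall fun _ => dist_nonneg)
      (h_dist _ _ _ _ (h_const v) hx) h2
  · refine (LipschitzWith.of_dist_le_mul (K := K) fun v w => ?_).continuous
    exact le_of_tendsto_of_tendsto ((hH v).dist (hH w))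
      (((h_const v).dist (h_const w)).const_mul (K : ℝ))
      (h_dist _ _ _ _ (h_const v) (h_const w))

lemma IsBlowUp.apply_zero {l : Filter ℝ} [l.NeBot] {h H : E → E} (hH : IsBlowUp l h H)
    (h0 : h 0 = 0) : H 0 = 0 := by
  have := hH (fun _ => 0) 0 (by simp)
  simp only [h0, smul_zero] at this
  exact tendsto_nhds_unique this tendsto_const_nhds

lemma IsBlowUp.leftInverse {l : Filter ℝ} [l.NeBot] (hl : l ≤ 𝓝[>] 0) {h g H G : E → E}
    (hH : IsBlowUp l h H) (hG : IsBlowUp l g G) {U : Set E} (hU : U ∈ 𝓝 0)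
    (hgh : ∀ x ∈ U, g (h x) = x) : Function.LeftInverse G H := by
  intro v
  have hv : Tendsto (fun s : ℝ => s⁻¹ • s • v) l (𝓝 v) :=
    tendsto_inv_smul_smul hl tendsto_const_nhds
  have h1 := hG _ _ (hH _ _ hv)
  refine tendsto_nhds_unique (h1.congr' ?_) hv
  filter_upwards [tendsto_zero_of_tendsto_inv_smul hl hv hU] with s hs
  rw [hgh _ hs]

lemma IsBlowUp.mapsTo {l : Filter ℝ} (hl : l ≤ 𝓝[>] 0) {h H : E → E}
    (hH : IsBlowUp l h H) {U X Y : Set E} (hU : U ∈ 𝓝 0) (hXY : MapsTo h (X ∩ U) Y) :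
    MapsTo H (tangentConeAlong l X) (tangentConeAlong l Y) := by
  rintro v ⟨x, hx, hv⟩
  refine ⟨fun s => h (x s), ?_, hH _ _ hv⟩
  filter_upwards [hx, tendsto_zero_of_tendsto_inv_smul hl hv hU] with s h1 h2
  exact hXY ⟨h1, h2⟩

end BlowUp

/-! ### The tangent cones of the surfaces -/

/-- The homogeneous quartic whose zero set is the cone over two tangent circles. -/
def eightForm (p : EuclideanSpace ℝ (Fin 3)) : ℝ :=
  (p 0 ^ 2 - 2 * p 0 * p 2 + p 1 ^ 2) * (p 0 ^ 2 + 2 * p 0 * p 2 + p 1 ^ 2)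

/-- The quadratic form vanishing on the cone over the circle with centre `(a, b)` and
radius `r`. -/
def circleForm (a b r : ℝ) (p : EuclideanSpace ℝ (Fin 3)) : ℝ :=
  (p 0 - a * p 2) ^ 2 + (p 1 - b * p 2) ^ 2 - r ^ 2 * p 2 ^ 2

/-- The surfaces of the form of `ExampleX1` and `ExampleX2`, with small circles centred
at `(a, b)` and `(c, d)`. -/
def peanutSurface (k : ℕ) (a b c d : ℝ) : Set (EuclideanSpace ℝ (Fin 3)) :=
  {p | (eightForm p - p 2 ^ k) * circleForm a b (1 / 4) p * circleForm c d (1 / 4) p = 0 ∧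
    0 ≤ p 2}

lemma exampleX1_eq (k : ℕ) : ExampleX1 k = peanutSurface k 1 (1 / 2) 1 (-1 / 2) := by
  ext p
  simp only [ExampleX1, peanutSurface, eightForm, circleForm, mem_ofPred_eq]
  ring_nf

lemma exampleX2_eq (k : ℕ) : ExampleX2 k = peanutSurface k 1 0 (-1) 0 := by
  ext p
  simp only [ExampleX2, peanutSurface, eightForm, circleForm, mem_ofPred_eq]
  ring_nf

lemma eightForm_vec (x y t : ℝ) : eightForm !₂[x, y, t] =
    (x ^ 2 - 2 * x * t + y ^ 2) * (x ^ 2 + 2 * x * t + y ^ 2) := rfl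

lemma circleForm_vec (a b r x y t : ℝ) : circleForm a b r !₂[x, y, t] =
    (x - a * t) ^ 2 + (y - b * t) ^ 2 - r ^ 2 * t ^ 2 := rfl

lemma eightForm_smul (s : ℝ) (p : EuclideanSpace ℝ (Fin 3)) :
    eightForm (s • p) = s ^ 4 * eightForm p := by
  simp only [eightForm, PiLp.smul_apply, smul_eq_mul]
  ring

lemma circleForm_smul (a b r s : ℝ) (p : EuclideanSpace ℝ (Fin 3)) :
    circleForm a b r (s • p) = s ^ 2 * circleForm a b r p := by
  simp only [circleForm, PiLp.smul_apply, smul_eq_mul]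
  ring

@[fun_prop]
lemma continuous_eightForm : Continuous eightForm := by
  unfold eightForm
  fun_prop

@[fun_prop]
lemma continuous_circleForm (a b r : ℝ) : Continuous (circleForm a b r) := by
  unfold circleForm
  fun_prop

lemma eightForm_sub_smul {k : ℕ} (hk : 4 < k) (s : ℝ) (p : EuclideanSpace ℝ (Fin 3)) :
    eightForm (s • p) - (s • p) 2 ^ k = s ^ 4 * (eightForm p - s ^ (k - 4) * p 2 ^ k) := by
  rw [eightForm_smul, PiLp.smul_apply, smul_eq_mul, mul_pow, mul_sub, ← mul_assoc, ← pow_add,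
    show 4 + (k - 4) = k by omega]

/-- The cone over the circle with centre `(a, b)` and radius `r`, without its vertex. -/
def circleCone (a b r : ℝ) : Set (EuclideanSpace ℝ (Fin 3)) :=
  {p | circleForm a b r p = 0 ∧ 0 < p 2}

/-- The cone over two tangent circles, without its vertex. -/
def eightCone : Set (EuclideanSpace ℝ (Fin 3)) :=
  circleCone 1 0 1 ∪ circleCone (-1) 0 1

lemma eightForm_eq (p : EuclideanSpace ℝ (Fin 3)) :
    eightForm p = circleForm 1 0 1 p * circleForm (-1) 0 1 p := by
  simp only [eightForm, circleForm]
  ring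

lemma mem_eightCone {p : EuclideanSpace ℝ (Fin 3)} :
    p ∈ eightCone ↔ eightForm p = 0 ∧ 0 < p 2 := by
  simp only [eightCone, circleCone, eightForm_eq, mul_eq_zero, mem_union, mem_ofPred_eq]
  tauto

lemma tangentConeAlong_peanutSurface_subset {l : Filter ℝ} [l.NeBot] (hl : l ≤ 𝓝[>] 0) {k : ℕ}
    (hk : 4 < k) (a b c d : ℝ) {v : EuclideanSpace ℝ (Fin 3)}
    (hv : v ∈ tangentConeAlong l (peanutSurface k a b c d)) :
    eightForm v * circleForm a b (1 / 4) v * circleForm c d (1 / 4) v = 0 ∧ 0 ≤ v 2 := by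
  obtain ⟨x, hx, hv⟩ := hv
  have hmem : ∀ᶠ s in l, (eightForm (s⁻¹ • x s) - s ^ (k - 4) * (s⁻¹ • x s) 2 ^ k) *
      circleForm a b (1 / 4) (s⁻¹ • x s) * circleForm c d (1 / 4) (s⁻¹ • x s) = 0 ∧
      0 ≤ (s⁻¹ • x s) 2 := by
    filter_upwards [hx, eventually_pos_of_le hl] with s h1 hs
    generalize hq : s⁻¹ • x s = q
    have hxq : x s = s • q := by rw [← hq, smul_inv_smul₀ hs.ne']
    rw [hxq] at h1
    obtain ⟨h1, h2⟩ := h1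
    rw [eightForm_sub_smul hk, circleForm_smul, circleForm_smul] at h1
    rw [PiLp.smul_apply, smul_eq_mul] at h2
    refine ⟨?_, nonneg_of_mul_nonneg_right h2 hs⟩
    have hs4 : s ^ 4 * s ^ 2 * s ^ 2 ≠ 0 := by positivity
    refine (mul_eq_zero.1 ?_).resolve_left hs4
    rw [← h1]
    ring
  constructor
  · have hcont : Continuous fun z : ℝ × EuclideanSpace ℝ (Fin 3) =>
        (eightForm z.2 - z.1 ^ (k - 4) * z.2 2 ^ k) *
          circleForm a b (1 / 4) z.2 * circleForm c d (1 / 4) z.2 := by fun_prop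
    have hlim := (hcont.tendsto (0, v)).comp ((tendsto_id_of_le hl).prodMk_nhds hv)
    have := tendsto_nhds_unique (hlim.congr' (hmem.mono fun s hs => hs.1)) tendsto_const_nhds
    simpa [zero_pow (show k - 4 ≠ 0 by omega)] using this
  · have hcont : Continuous fun p : EuclideanSpace ℝ (Fin 3) => p 2 := by fun_prop
    exact ge_of_tendsto ((hcont.tendsto v).comp hv) (hmem.mono fun s hs => hs.2)

lemma mem_union_of_mem_tangentConeAlong {l : Filter ℝ} [l.NeBot] (hl : l ≤ 𝓝[>] 0) {k : ℕ}
    (hk : 4 < k) (a b c d : ℝ) {v : EuclideanSpace ℝ (Fin 3)} (hv0 : v ≠ 0)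
    (hv : v ∈ tangentConeAlong l (peanutSurface k a b c d)) :
    v ∈ eightCone ∨ v ∈ circleCone a b (1 / 4) ∨ v ∈ circleCone c d (1 / 4) := by
  obtain ⟨h1, h2⟩ := tangentConeAlong_peanutSurface_subset hl hk a b c d hv
  have ht : 0 < v 2 := by
    refine h2.lt_of_ne' fun h0 => hv0 ?_
    have hsq : v 0 ^ 2 + v 1 ^ 2 = 0 := by
      have h3 : (v 0 ^ 2 + v 1 ^ 2) ^ 4 = 0 := by
        rw [← h1]
        simp only [eightForm, circleForm, h0]
        ring
      exact pow_eq_zero_iff (by norm_num) |>.1 h3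
    ext i
    fin_cases i
    · exact (pow_eq_zero_iff two_ne_zero).1
        (by nlinarith [sq_nonneg (v 0), sq_nonneg (v 1)] : v 0 ^ 2 = 0)
    · exact (pow_eq_zero_iff two_ne_zero).1
        (by nlinarith [sq_nonneg (v 0), sq_nonneg (v 1)] : v 1 ^ 2 = 0)
    · simpa using h0
  rw [mul_eq_zero, mul_eq_zero] at h1
  rcases h1 with (h1 | h1) | h1
  · exact Or.inl (mem_eightCone.2 ⟨h1, ht⟩)
  · exact Or.inr (Or.inl ⟨h1, ht⟩)
  · exact Or.inr (Or.inr ⟨h1, ht⟩)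

lemma circleCone_subset_left {l : Filter ℝ} (hl : l ≤ 𝓝[>] 0) (k : ℕ) (a b c d : ℝ) :
    circleCone a b (1 / 4) ⊆ tangentConeAlong l (peanutSurface k a b c d) := by
  intro v hv
  refine mem_tangentConeAlong_of_smul hl (fun _ => v) tendsto_const_nhds fun s hs => ⟨?_, ?_⟩
  · rw [circleForm_smul, hv.1]
    ring
  · exact mul_nonneg hs.le hv.2.le

lemma circleCone_subset_right {l : Filter ℝ} (hl : l ≤ 𝓝[>] 0) (k : ℕ) (a b c d : ℝ) :
    circleCone c d (1 / 4) ⊆ tangentConeAlong l (peanutSurface k a b c d) := by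
  intro v hv
  refine mem_tangentConeAlong_of_smul hl (fun _ => v) tendsto_const_nhds fun s hs => ⟨?_, ?_⟩
  · rw [circleForm_smul c, hv.1]
    ring
  · exact mul_nonneg hs.le hv.2.le

lemma exists_eightForm_eq {x y t σ ε : ℝ} (hσ : σ ^ 2 = 1) (hσy : 0 ≤ σ * y) (hε : 0 ≤ ε)
    (h0 : eightForm !₂[x, y, t] = 0) :
    ∃ δ ∈ Icc 0 √√ε, eightForm !₂[x, y + σ * δ, t] = ε := by
  have hcont : Continuous fun δ : ℝ => eightForm !₂[x, y + σ * δ, t] := by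
    simp only [eightForm, Matrix.cons_val]
    fun_prop
  refine intermediate_value_Icc (Real.sqrt_nonneg _) hcont.continuousOn ⟨by simp [h0, hε], ?_⟩
  set δ := √√ε
  have hδ : 0 ≤ δ := Real.sqrt_nonneg _
  have hδ4 : ε = δ ^ 4 := by
    rw [show δ ^ 4 = (δ ^ 2) ^ 2 by ring, Real.sq_sqrt (Real.sqrt_nonneg _), Real.sq_sqrt hε]
  have key : eightForm !₂[x, y + σ * δ, t] = eightForm !₂[x, y, t] +
      2 * (x ^ 2 + y ^ 2) * (2 * (σ * y) * δ + δ ^ 2) + (2 * (σ * y) * δ + δ ^ 2) ^ 2 := by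
    have h1 : (y + σ * δ) ^ 2 = y ^ 2 + (2 * (σ * y) * δ + δ ^ 2) := by
      linear_combination δ ^ 2 * hσ
    simp only [eightForm, Matrix.cons_val, h1]
    ring
  simp only [key, h0, hδ4]
  have h2 : 0 ≤ (σ * y) * δ := mul_nonneg hσy hδ
  have h3 : 0 ≤ (x ^ 2 + y ^ 2) * (2 * (σ * y) * δ + δ ^ 2) :=
    mul_nonneg (by positivity) (by nlinarith [sq_nonneg δ])
  nlinarith [mul_nonneg h2 (sq_nonneg δ), sq_nonneg (σ * y * δ)]

lemma eightCone_subset {l : Filter ℝ} (hl : l ≤ 𝓝[>] 0) {k : ℕ} (hk : 4 < k)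
    (a b c d : ℝ) : eightCone ⊆ tangentConeAlong l (peanutSurface k a b c d) := by
  intro v hv
  obtain ⟨h0, ht⟩ := mem_eightCone.1 hv
  have hveq : v = !₂[v 0, v 1, v 2] := by
    ext i
    fin_cases i <;> rfl
  obtain ⟨σ, hσ, hσy⟩ : ∃ σ : ℝ, σ ^ 2 = 1 ∧ 0 ≤ σ * v 1 := by
    rcases le_total 0 (v 1) with h | h
    · exact ⟨1, by norm_num, by linarith⟩
    · exact ⟨-1, by norm_num, by linarith⟩
  have hex : ∀ s : ℝ, ∃ δ : ℝ, 0 < s → δ ∈ Icc 0 √√(s ^ (k - 4) * v 2 ^ k) ∧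
      eightForm !₂[v 0, v 1 + σ * δ, v 2] = s ^ (k - 4) * v 2 ^ k := by
    intro s
    by_cases hs : 0 < s
    · obtain ⟨δ, h1, h2⟩ := exists_eightForm_eq (ε := s ^ (k - 4) * v 2 ^ k) hσ hσy
        (by positivity) (hveq ▸ h0)
      exact ⟨δ, fun _ => ⟨h1, h2⟩⟩
    · exact ⟨0, fun h => absurd h hs⟩
  choose δ hδ using hex
  have hδ0 : Tendsto δ l (𝓝 0) := by
    have hcont : Continuous fun s : ℝ => √√(s ^ (k - 4) * v 2 ^ k) := by fun_prop
    have hlim := (hcont.tendsto 0).comp (tendsto_id_of_le hl)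
    simp only [zero_pow (show k - 4 ≠ 0 by omega), zero_mul, Real.sqrt_zero] at hlim
    exact squeeze_zero' ((eventually_pos_of_le hl).mono fun s hs => (hδ s hs).1.1)
      ((eventually_pos_of_le hl).mono fun s hs => (hδ s hs).1.2) hlim
  refine mem_tangentConeAlong_of_smul hl (fun s => !₂[v 0, v 1 + σ * δ s, v 2]) ?_
    fun s hs => ⟨?_, ?_⟩
  · have hcont : Continuous fun r : ℝ => !₂[v 0, v 1 + σ * r, v 2] := by fun_prop
    have hlim := (hcont.tendsto 0).comp hδ0
    rw [mul_zero, add_zero, ← hveq] at hlim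
    exact hlim
  · rw [eightForm_sub_smul hk, (hδ s hs).2]
    simp
  · exact mul_nonneg hs.le ht.le

/-! ### Connectedness and separation -/

lemma isPreconnected_circleCone (a b : ℝ) {r : ℝ} (hr : 0 < r) :
    IsPreconnected (circleCone a b r) := by
  have hcont : Continuous fun z : ℝ × ℝ =>
      !₂[z.1 * (a + r * Real.cos z.2), z.1 * (b + r * Real.sin z.2), z.1] := by fun_prop
  have himage : circleCone a b r = (fun z : ℝ × ℝ =>
      !₂[z.1 * (a + r * Real.cos z.2), z.1 * (b + r * Real.sin z.2), z.1]) ''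
        (Ioi 0 ×ˢ univ) := by
    ext p
    constructor
    · rintro ⟨hp, ht⟩
      have hrt : 0 < r * p 2 := mul_pos hr ht
      set z : ℂ := ⟨(p 0 - a * p 2) / (r * p 2), (p 1 - b * p 2) / (r * p 2)⟩ with hz
      have hnorm : ‖z‖ = 1 := by
        rw [← sq_eq_sq₀ (norm_nonneg _) zero_le_one, Complex.sq_norm, Complex.normSq_apply]
        simp only [circleForm] at hp
        simp only [hz]
        field_simp
        linarith
      have hcos := Complex.norm_mul_cos_arg z
      have hsin := Complex.norm_mul_sin_arg z
      rw [hnorm, one_mul] at hcos hsin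
      refine ⟨(p 2, z.arg), ⟨ht, mem_univ _⟩, ?_⟩
      ext i
      fin_cases i
      · simp [hcos]
        rw [hz]
        field_simp
        ring
      · simp [hsin]
        rw [hz]
        field_simp
        ring
      · rfl
    · rintro ⟨⟨t, θ⟩, ⟨ht, -⟩, rfl⟩
      refine ⟨?_, ht⟩
      simp only [circleForm, Matrix.cons_val]
      linear_combination r ^ 2 * t ^ 2 * Real.sin_sq_add_cos_sq θ
  rw [himage]
  exact (isPreconnected_Ioi.prod isPreconnected_univ).image _ hcont.continuousOn

lemma isPreconnected_eightCone : IsPreconnected eightCone :=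
  IsPreconnected.union !₂[0, 0, 1] (by simp [circleCone, circleForm])
    (by simp [circleCone, circleForm])
    (isPreconnected_circleCone _ _ one_pos) (isPreconnected_circleCone _ _ one_pos)

lemma IsPreconnected.forall_neg_or_forall_pos {α : Type*} [TopologicalSpace α] {S : Set α}
    (hS : IsPreconnected S) {f : α → ℝ} (hf : Continuous f) (h0 : ∀ p ∈ S, f p ≠ 0) :
    (∀ p ∈ S, f p < 0) ∨ ∀ p ∈ S, 0 < f p := by
  by_contra! hcon
  obtain ⟨⟨p, hp, hp0⟩, q, hq, hq0⟩ := hcon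
  obtain ⟨r, hr, hr0⟩ := hS.intermediate_value hq hp hf.continuousOn ⟨hq0, hp0⟩
  exact h0 r hr hr0

/-- The cone over the circle of radius `3 / 8` concentric with one of the small circles
on the right avoids the other curves of the tangent cone of `X₁`. -/
lemma circleForm_ne_zero_of_mem {e : ℝ} (he : e ^ 2 = 1) {p : EuclideanSpace ℝ (Fin 3)}
    (hp : p ∈ eightCone ∨ p ∈ circleCone 1 (e / 2) (1 / 4) ∨
      p ∈ circleCone 1 (-e / 2) (1 / 4)) : circleForm 1 (e / 2) (3 / 8) p ≠ 0 := by
  simp only [eightCone, circleCone, circleForm, mem_union, mem_ofPred_eq] at hp ⊢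
  generalize p 0 = x at hp ⊢
  generalize p 1 = y at hp ⊢
  generalize p 2 = t at hp ⊢
  have hey : y ^ 2 = (e * y) ^ 2 := by rw [mul_pow, he, one_mul]
  have h1 : (y - e / 2 * t) ^ 2 = y ^ 2 - (e * y) * t + t ^ 2 / 4 := by
    linear_combination t ^ 2 / 4 * he
  have h2 : (y - -e / 2 * t) ^ 2 = y ^ 2 + (e * y) * t + t ^ 2 / 4 := by
    linear_combination t ^ 2 / 4 * he
  have h3 : (y - 0 * t) ^ 2 = y ^ 2 := by ring
  rw [h1, h2, h3, hey] at hp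
  rw [h1, hey]
  generalize e * y = z at hp ⊢
  intro h
  rcases hp with (⟨h4, ht⟩ | ⟨h4, ht⟩) | ⟨h4, ht⟩ | ⟨h4, ht⟩
  · have hz : t * (71 / 64 * t - z) = 0 := by linarith
    have hz' : z = 71 / 64 * t := by linarith [(mul_eq_zero.1 hz).resolve_left ht.ne']
    subst hz'
    nlinarith [sq_nonneg (x - 1 * t)]
  · have hz : t * (71 / 64 * t - z - 4 * x) = 0 := by linarith
    have hz' : z = 71 / 64 * t - 4 * x := by linarith [(mul_eq_zero.1 hz).resolve_left ht.ne']
    have hx : x ≤ 0 := by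
      by_contra! hx
      nlinarith [sq_nonneg z]
    have hzt : t < z := by linarith
    nlinarith [sq_nonneg (x - -1 * t)]
  · nlinarith
  · have hz : t * (5 / 128 * t + z) = 0 := by linarith
    have hz' : z = -(5 / 128 * t) := by linarith [(mul_eq_zero.1 hz).resolve_left ht.ne']
    subst hz'
    nlinarith [sq_nonneg (x - 1 * t)]

/-- A preconnected subset of `C \ {0}`, for `C` the tangent cone of `X₁`, does not meet two
of the three pieces of `C \ {0}`. -/
lemma not_mem_and_mem_of_isPreconnected {S : Set (EuclideanSpace ℝ (Fin 3))}
    (hS : IsPreconnected S)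
    (hSC : ∀ p ∈ S, p ∈ eightCone ∨ p ∈ circleCone 1 (1 / 2) (1 / 4) ∨
      p ∈ circleCone 1 (-1 / 2) (1 / 4)) :
    ¬ (!₂[2, 0, 1] ∈ S ∧ !₂[1, 1 / 4, 1] ∈ S) ∧ ¬ (!₂[2, 0, 1] ∈ S ∧ !₂[1, -1 / 4, 1] ∈ S) ∧
      ¬ (!₂[1, 1 / 4, 1] ∈ S ∧ !₂[1, -1 / 4, 1] ∈ S) := by
  have h1 := hS.forall_neg_or_forall_pos (continuous_circleForm 1 (1 / 2) (3 / 8))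
    fun p hp => circleForm_ne_zero_of_mem (e := 1) (by norm_num) (hSC p hp)
  have h2 := hS.forall_neg_or_forall_pos (continuous_circleForm 1 (-1 / 2) (3 / 8))
    fun p hp => circleForm_ne_zero_of_mem (e := -1) (by norm_num) (by
      have := hSC p hp
      rw [neg_neg]
      tauto)
  refine ⟨fun ⟨ha, hb⟩ => ?_, fun ⟨ha, hb⟩ => ?_, fun ⟨ha, hb⟩ => ?_⟩
  · rcases h1 with h1 | h1
    · have := h1 _ ha
      norm_num [circleForm_vec] at this
    · have := h1 _ hb
      norm_num [circleForm_vec] at this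
  · rcases h2 with h2 | h2
    · have := h2 _ ha
      norm_num [circleForm_vec] at this
    · have := h2 _ hb
      norm_num [circleForm_vec] at this
  · rcases h1 with h1 | h1
    · have := h1 _ hb
      norm_num [circleForm_vec] at this
    · have := h1 _ ha
      norm_num [circleForm_vec] at this

/-- A preconnected set avoiding the cone over two tangent circles cannot accumulate inside
both lobes of that cone. -/
lemma not_mem_closure_and_mem_closure {S : Set (EuclideanSpace ℝ (Fin 3))}
    (hS : IsPreconnected S) (h0 : 0 ∉ S) (hE : Disjoint S eightCone)
    {p q : EuclideanSpace ℝ (Fin 3)} (hp : p ∈ circleCone 1 0 (1 / 4))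
    (hq : q ∈ circleCone (-1) 0 (1 / 4)) (hpS : p ∈ closure S) : q ∉ closure S := by
  intro hqS
  set f : EuclideanSpace ℝ (Fin 3) → ℝ := fun p => √((p 0 - p 2) ^ 2 + p 1 ^ 2) - p 2 with hf
  have hfc : Continuous f := by fun_prop
  have hfS : ∀ v ∈ S, f v ≠ 0 := by
    intro v hv hfv
    have hsqrt : √((v 0 - v 2) ^ 2 + v 1 ^ 2) = v 2 := by
      simpa [hf, sub_eq_zero] using hfv
    have ht : 0 ≤ v 2 := hsqrt ▸ Real.sqrt_nonneg _
    have hsq : (v 0 - v 2) ^ 2 + v 1 ^ 2 = v 2 ^ 2 :=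
      (Real.sqrt_eq_iff_eq_sq (by positivity) ht).1 hsqrt
    rcases ht.eq_or_lt with ht | ht
    · rw [← ht] at hsq
      have hx : v 0 = 0 := by nlinarith [sq_nonneg (v 0), sq_nonneg (v 1)]
      have hy : v 1 = 0 := by nlinarith [sq_nonneg (v 0), sq_nonneg (v 1)]
      refine h0 ?_
      convert hv
      ext i
      fin_cases i <;> simp [hx, hy, ← ht]
    · refine disjoint_left.1 hE hv (Or.inl ⟨?_, ht⟩)
      simp only [circleForm]
      linarith
  have hfp : f p < 0 := by
    obtain ⟨h, ht⟩ := hp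
    simp only [circleForm] at h
    have : √((p 0 - p 2) ^ 2 + p 1 ^ 2) = p 2 / 4 := by
      rw [Real.sqrt_eq_iff_eq_sq (by positivity) (by positivity)]
      linarith
    simp only [hf, this]
    linarith
  have hfq : 0 < f q := by
    obtain ⟨h, ht⟩ := hq
    simp only [circleForm] at h
    have hx : q 0 < 0 := by
      by_contra! hx
      nlinarith [sq_nonneg (q 1)]
    have : q 2 < √((q 0 - q 2) ^ 2 + q 1 ^ 2) := by
      refine Real.lt_sqrt_of_sq_lt ?_
      nlinarith [sq_nonneg (q 1), sq_nonneg (q 0)]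
    simp only [hf]
    linarith
  rcases hS.forall_neg_or_forall_pos hfc hfS with h | h
  · exact hfq.not_ge (closure_minimal (fun v hv => (h v hv).le)
      (isClosed_le hfc continuous_const) hqS)
  · exact hfp.not_ge (closure_minimal (fun v hv => (h v hv).le)
      (isClosed_le continuous_const hfc) hpS)

/-- A connected set in the complement of the tangent cone of `X₁` which joins its three
pieces. -/
def joiningSet : Set (EuclideanSpace ℝ (Fin 3)) :=
  (fun y : ℝ => !₂[1, y, 1]) '' Ioo (-1 / 4) (1 / 4) ∪ (fun x : ℝ => !₂[x, 0, 1]) '' Ico 1 2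

lemma isPreconnected_joiningSet : IsPreconnected joiningSet := by
  refine IsPreconnected.union !₂[1, 0, 1] ⟨0, by norm_num, rfl⟩ ⟨1, by norm_num, rfl⟩ ?_ ?_
  · exact isPreconnected_Ioo.image _ (by fun_prop)
  · exact isPreconnected_Ico.image _ (by fun_prop)

lemma mem_closure_joiningSet_of_mem_Icc {y : ℝ} (hy : y ∈ Icc (-1 / 4) (1 / 4)) :
    !₂[1, y, 1] ∈ closure joiningSet := by
  have hcont : Continuous fun y : ℝ => !₂[1, y, 1] := by fun_prop
  rw [← closure_Ioo (by norm_num)] at hy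
  exact closure_mono subset_union_left (image_closure_subset_closure_image hcont ⟨y, hy, rfl⟩)

lemma mem_closure_joiningSet : !₂[2, 0, 1] ∈ closure joiningSet := by
  have hcont : Continuous fun x : ℝ => !₂[x, 0, 1] := by fun_prop
  have h2 : (2 : ℝ) ∈ closure (Ico 1 2) := by
    rw [closure_Ico (by norm_num)]
    norm_num
  exact closure_mono subset_union_right (image_closure_subset_closure_image hcont ⟨2, h2, rfl⟩)

lemma forms_ne_zero_of_mem_joiningSet {p : EuclideanSpace ℝ (Fin 3)} (hp : p ∈ joiningSet) :
    eightForm p * circleForm 1 (1 / 2) (1 / 4) p * circleForm 1 (-1 / 2) (1 / 4) p ≠ 0 := by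
  rcases hp with ⟨y, ⟨h1, h2⟩, rfl⟩ | ⟨x, ⟨h1, h2⟩, rfl⟩
  · simp only [eightForm, circleForm, Matrix.cons_val]
    refine mul_ne_zero (mul_ne_zero (mul_ne_zero ?_ ?_) ?_) ?_ <;> intro h <;> nlinarith
  · simp only [eightForm, circleForm, Matrix.cons_val]
    refine mul_ne_zero (mul_ne_zero (mul_ne_zero ?_ ?_) ?_) ?_ <;> intro h <;> nlinarith

/-- Three points lying in three sets, no two of them in the same set, meet each of two given
sets among the three. -/
lemma false_of_three_pieces {α : Type*} {A B C : Set α} {x y z : α}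
    (hA : ¬ (x ∈ A ∧ y ∈ A) ∧ ¬ (x ∈ A ∧ z ∈ A) ∧ ¬ (y ∈ A ∧ z ∈ A))
    (hB : ¬ (x ∈ B ∧ y ∈ B) ∧ ¬ (x ∈ B ∧ z ∈ B) ∧ ¬ (y ∈ B ∧ z ∈ B))
    (hC : ¬ (x ∈ C ∧ y ∈ C) ∧ ¬ (x ∈ C ∧ z ∈ C) ∧ ¬ (y ∈ C ∧ z ∈ C))
    (hx : x ∈ A ∨ x ∈ B ∨ x ∈ C) (hy : y ∈ A ∨ y ∈ B ∨ y ∈ C) (hz : z ∈ A ∨ z ∈ B ∨ z ∈ C)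
    (hBC : (x ∈ B → y ∈ C → False) ∧ (y ∈ B → x ∈ C → False) ∧ (x ∈ B → z ∈ C → False) ∧
      (z ∈ B → x ∈ C → False) ∧ (y ∈ B → z ∈ C → False) ∧ (z ∈ B → y ∈ C → False)) :
    False := by
  grind

/-- Theorem 2.1, non-equivalence part: for any integer `k > 4`, the germs
at the origin of the surfaces `X₁` and `X₂` of Example 1 are NOT ambient Lipschitz
equivalent. -/
theorem example1_not_ambient_Lipschitz_equiv (k : ℕ) (hk : 4 < k) :
    ¬ AmbientLipEquiv (ExampleX1 k) (ExampleX2 k) := by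
  rintro ⟨U, V, hUo, hVo, hU0, hV0, h, g, hUV, hVU, hgh, hhg, ⟨K, hh, hg⟩, h0, himage⟩
  rw [exampleX1_eq, exampleX2_eq] at himage
  have hU := hUo.mem_nhds hU0
  have hV := hVo.mem_nhds hV0
  have g0 : g 0 = 0 := by simpa [h0] using hgh 0 hU0
  set l : Ultrafilter ℝ := Ultrafilter.of (𝓝[>] 0)
  have hl : (l : Filter ℝ) ≤ 𝓝[>] 0 := Ultrafilter.of_le _
  obtain ⟨H, hH, hHc⟩ := exists_isBlowUp hl hU hh h0
  obtain ⟨G, hG, hGc⟩ := exists_isBlowUp hl hV hg g0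
  have hGH : Function.LeftInverse G H := hH.leftInverse hl hG hU hgh
  have hHG : Function.LeftInverse H G := hG.leftInverse hl hH hV hhg
  have hH0 := hH.apply_zero h0
  have hG0 := hG.apply_zero g0
  have hHC := hH.mapsTo hl hU fun x hx => (himage ▸ mem_image_of_mem h hx :
    h x ∈ peanutSurface k 1 0 (-1) 0 ∩ V).1
  have hGC : MapsTo G (tangentConeAlong l (peanutSurface k 1 0 (-1) 0))
      (tangentConeAlong l (peanutSurface k 1 (1 / 2) 1 (-1 / 2))) := by
    refine hG.mapsTo hl hV fun y hy => ?_
    rw [← himage] at hy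
    obtain ⟨x, hx, rfl⟩ := hy
    rw [hgh x hx.2]
    exact hx.1
  have hpieces : ∀ p : EuclideanSpace ℝ (Fin 3),
      p ∈ tangentConeAlong l (peanutSurface k 1 (1 / 2) 1 (-1 / 2)) → p 2 = 1 →
      H p ∈ eightCone ∨ H p ∈ circleCone 1 0 (1 / 4) ∨ H p ∈ circleCone (-1) 0 (1 / 4) := by
    intro p hp hp1
    refine mem_union_of_mem_tangentConeAlong hl hk _ _ _ _ (fun h => ?_) (hHC hp)
    have hp0 : p = 0 := by rw [← hGH p, h, hG0]
    simp [hp0] at hp1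
  have hsep : ∀ T : Set (EuclideanSpace ℝ (Fin 3)), IsPreconnected T → (∀ v ∈ T, 0 < v 2) →
      T ⊆ tangentConeAlong l (peanutSurface k 1 0 (-1) 0) →
      ¬ (H !₂[2, 0, 1] ∈ T ∧ H !₂[1, 1 / 4, 1] ∈ T) ∧
        ¬ (H !₂[2, 0, 1] ∈ T ∧ H !₂[1, -1 / 4, 1] ∈ T) ∧
        ¬ (H !₂[1, 1 / 4, 1] ∈ T ∧ H !₂[1, -1 / 4, 1] ∈ T) := by
    intro T hT hT0 hTC
    have := not_mem_and_mem_of_isPreconnected (hT.image G hGc.continuousOn) (by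
      rintro _ ⟨v, hv, rfl⟩
      refine mem_union_of_mem_tangentConeAlong hl hk _ _ _ _ (fun h => ?_) (hGC (hTC hv))
      have hv0 : v = 0 := by rw [← hHG v, h, hH0]
      simpa [hv0] using hT0 v hv)
    simpa only [image_eq_preimage_of_inverse hHG hGH, mem_preimage] using this
  have hsepE := hsep eightCone isPreconnected_eightCone (fun v hv => (mem_eightCone.1 hv).2)
    (eightCone_subset hl hk _ _ _ _)
  have hsepR := hsep (circleCone 1 0 (1 / 4)) (isPreconnected_circleCone _ _ (by norm_num))
    (fun v hv => hv.2) (circleCone_subset_left hl k _ _ _ _)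
  have hsepL := hsep (circleCone (-1) 0 (1 / 4)) (isPreconnected_circleCone _ _ (by norm_num))
    (fun v hv => hv.2) (circleCone_subset_right hl k _ _ _ _)
  have hjoin : ∀ p ∈ closure joiningSet, ∀ q ∈ closure joiningSet,
      H p ∈ circleCone 1 0 (1 / 4) → H q ∈ circleCone (-1) 0 (1 / 4) → False := by
    intro p hp q hq hpR hqL
    have hdisj : ∀ v ∈ joiningSet, H v ∉ tangentConeAlong l (peanutSurface k 1 0 (-1) 0) := by
      intro v hv hHv
      have := hGC hHv
      rw [hGH v] at this
      exact forms_ne_zero_of_mem_joiningSet hv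
        (tangentConeAlong_peanutSurface_subset hl hk _ _ _ _ this).1
    refine not_mem_closure_and_mem_closure
      (isPreconnected_joiningSet.image H hHc.continuousOn) ?_ ?_ hpR hqL
      (image_closure_subset_closure_image hHc (mem_image_of_mem H hp))
      (image_closure_subset_closure_image hHc (mem_image_of_mem H hq))
    · rintro ⟨v, hv, hv0⟩
      refine hdisj v hv (hv0 ▸ mem_tangentConeAlong_of_smul hl (fun _ => 0) tendsto_const_nhds
        fun s hs => ?_)
      simp [peanutSurface, circleForm]
    · rw [disjoint_left]
      rintro _ ⟨v, hv, rfl⟩ hE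
      exact hdisj v hv (eightCone_subset hl hk _ _ _ _ hE)
  have hc1 := mem_closure_joiningSet
  have hc2 := mem_closure_joiningSet_of_mem_Icc (y := 1 / 4) (by norm_num)
  have hc3 := mem_closure_joiningSet_of_mem_Icc (y := -1 / 4) (by norm_num)
  have hp1 := hpieces !₂[2, 0, 1] (eightCone_subset hl hk _ _ _ _
    (mem_eightCone.2 ⟨by norm_num [eightForm_vec], one_pos⟩)) rfl
  have hp2 := hpieces !₂[1, 1 / 4, 1] (circleCone_subset_left hl k _ _ _ _
    ⟨by norm_num [circleForm_vec], one_pos⟩) rfl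
  have hp3 := hpieces !₂[1, -1 / 4, 1] (circleCone_subset_right hl k _ _ _ _
    ⟨by norm_num [circleForm_vec], one_pos⟩) rfl
  exact false_of_three_pieces hsepE hsepR hsepL hp1 hp2 hp3
    ⟨hjoin _ hc1 _ hc2, hjoin _ hc2 _ hc1, hjoin _ hc1 _ hc3, hjoin _ hc3 _ hc1,
      hjoin _ hc2 _ hc3, hjoin _ hc3 _ hc2⟩
end
end

section
/- In ℝ³ with coordinates (x,y,t), let W = {(x,y,t) : ((x−t)²+y²−t²)((x+t)²+y²−t²) = 0 and t ≥ 0}, U₂ = {(x,y,t) : (x−t)²+(y−t/2)² = t²/16, t ≥ 0}, U₃ = {(x,y,t) : (x−t)²+(y+t/2)² = t²/16, t ≥ 0}, V₂ = {(x,y,t) : (x−t)²+y² = t²/16, t ≥ 0}, V₃ = {(x,y,t) : (x+t)²+y² = t²/16, t ≥ 0}. Then the germs at 0 of the cones C₁ = W ∪ U₂ ∪ U₃ and C₂ = W ∪ V₂ ∪ V₃ are NOT ambient topologically equivalent: there do not exist open neighborhoods U, V of 0 in ℝ³ and a homeomorphism h : U → V with h(0) = 0 and h(C₁ ∩ U)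 = C₂ ∩ V. -/
open Set Metric

noncomputable section

/-- The cone `W` over the two tangent circles `(x∓1)² + y² = 1` in the plane `t = 1`. -/
def ConeW : Set (EuclideanSpace ℝ (Fin 3)) :=
  {p | ((p 0 - p 2) ^ 2 + p 1 ^ 2 - p 2 ^ 2) * ((p 0 + p 2) ^ 2 + p 1 ^ 2 - p 2 ^ 2) = 0 ∧
        0 ≤ p 2}

/-- The piece `U₁` of Example 1 (coordinates `x = p 0`, `y = p 1`, `t = p 2`). -/
def PieceU1 (k : ℕ) : Set (EuclideanSpace ℝ (Fin 3)) :=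
  {p | ((p 0 - p 2) ^ 2 + p 1 ^ 2 - p 2 ^ 2) * ((p 0 + p 2) ^ 2 + p 1 ^ 2 - p 2 ^ 2) = p 2 ^ k ∧
        0 ≤ p 2}

/-- The cone `U₂` over the circle `(x-1)² + (y-1/2)² = 1/16`. -/
def PieceU2 : Set (EuclideanSpace ℝ (Fin 3)) :=
  {p | (p 0 - p 2) ^ 2 + (p 1 - p 2 / 2) ^ 2 = p 2 ^ 2 / 16 ∧ 0 ≤ p 2}

/-- The cone `U₃` over the circle `(x-1)² + (y+1/2)² = 1/16`. -/
def PieceU3 : Set (EuclideanSpace ℝ (Fin 3)) :=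
  {p | (p 0 - p 2) ^ 2 + (p 1 + p 2 / 2) ^ 2 = p 2 ^ 2 / 16 ∧ 0 ≤ p 2}

/-- The cone `V₂` over the circle `(x-1)² + y² = 1/16`. -/
def PieceV2 : Set (EuclideanSpace ℝ (Fin 3)) :=
  {p | (p 0 - p 2) ^ 2 + p 1 ^ 2 = p 2 ^ 2 / 16 ∧ 0 ≤ p 2}

/-- The cone `V₃` over the circle `(x+1)² + y² = 1/16`. -/
def PieceV3 : Set (EuclideanSpace ℝ (Fin 3)) :=
  {p | (p 0 + p 2) ^ 2 + p 1 ^ 2 = p 2 ^ 2 / 16 ∧ 0 ≤ p 2}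

lemma norm_le_three_mul {p : EuclideanSpace ℝ (Fin 3)} (h0 : |p 0| ≤ 2 * p 2)
    (h1 : |p 1| ≤ p 2) : ‖p‖ ≤ 3 * p 2 := by
  have ht : 0 ≤ p 2 := (abs_nonneg _).trans h1
  rw [EuclideanSpace.norm_eq, Real.sqrt_le_left (by positivity), Fin.sum_univ_three]
  simp only [Real.norm_eq_abs, sq_abs]
  nlinarith [sq_le_sq' (abs_le.mp h0).1 (abs_le.mp h0).2,
    sq_le_sq' (abs_le.mp h1).1 (abs_le.mp h1).2]

/-- The open part of height `< d` of the cone over the circle with centre `(a, 0)` and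
radius `b`. -/
def CircleCone (a b d : ℝ) : Set (EuclideanSpace ℝ (Fin 3)) :=
  {p | (p 0 - a * p 2) ^ 2 + p 1 ^ 2 = (b * p 2) ^ 2 ∧ 0 < p 2 ∧ p 2 < d}

lemma isPreconnected_circleCone_s7 {a b d : ℝ} (hb : 0 ≤ b) :
    IsPreconnected (CircleCone a b d) := by
  have himage : CircleCone a b d =
      (fun q : ℝ × ℝ ↦ (!₂[q.1 * (a + b * Real.cos q.2), q.1 * (b * Real.sin q.2), q.1] :
        EuclideanSpace ℝ (Fin 3))) '' (Ioo 0 d ×ˢ univ) := by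
    ext p
    constructor
    · rintro ⟨hp, h0, hd⟩
      have hn : ‖(⟨p 0 - a * p 2, p 1⟩ : ℂ)‖ = b * p 2 := by
        rw [Complex.norm_eq_sqrt_sq_add_sq, hp, Real.sqrt_sq (by positivity)]
      have hc := Complex.norm_mul_cos_arg ⟨p 0 - a * p 2, p 1⟩
      have hs := Complex.norm_mul_sin_arg ⟨p 0 - a * p 2, p 1⟩
      rw [hn] at hc hs
      refine ⟨(p 2, Complex.arg ⟨p 0 - a * p 2, p 1⟩), ⟨⟨h0, hd⟩, mem_univ _⟩, ?_⟩
      ext i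
      fin_cases i
      · simp only [] at hc ⊢
        simp
        linarith
      · simp only [] at hs ⊢
        simp
        linarith
      · simp
    · rintro ⟨⟨t, θ⟩, ⟨⟨h0, hd⟩, -⟩, rfl⟩
      refine ⟨?_, h0, hd⟩
      simp
      linear_combination (b * t) ^ 2 * Real.sin_sq_add_cos_sq θ
  rw [himage]
  refine (isPreconnected_Ioo.prod isPreconnected_univ).image _ (Continuous.continuousOn ?_)
  refine (PiLp.continuous_toLp 2 _).comp (continuous_pi fun i ↦ ?_)
  fin_cases i <;> simp <;> fun_prop

lemma CircleCone.subset_ball {a b d : ℝ} (ha : |a| = 1) (hb : 0 ≤ b) (hb' : b ≤ 1) :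
    CircleCone a b d ⊆ ball 0 (3 * d) := by
  rintro p ⟨hp, h0, hd⟩
  rw [mem_ball_zero_iff]
  refine (norm_le_three_mul ?_ ?_).trans_lt (by linarith)
  · have h1 : |p 0 - a * p 2| ≤ p 2 := abs_le_of_sq_le_sq (by
      nlinarith [sq_nonneg (p 1),
        mul_le_mul_of_nonneg_right (show b ^ 2 ≤ 1 by nlinarith) (sq_nonneg (p 2))]) h0.le
    rcases (abs_eq zero_le_one).mp ha with rfl | rfl <;>
      rw [abs_le] at * <;> constructor <;> linarith
  · exact abs_le_of_sq_le_sq (by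
      nlinarith [sq_nonneg (p 0 - a * p 2),
        mul_le_mul_of_nonneg_right (show b ^ 2 ≤ 1 by nlinarith) (sq_nonneg (p 2))]) h0.le

lemma isPreconnected_circleCone_union {d : ℝ} :
    IsPreconnected (CircleCone 1 1 d ∪ CircleCone (-1) 1 d) := by
  rcases le_or_gt d 0 with hd | hd
  · have hempty : CircleCone 1 1 d ∪ CircleCone (-1) 1 d = ∅ := by
      ext p
      simp only [CircleCone, mem_union, mem_ofPred_eq, mem_empty_iff_false, iff_false]
      rintro (⟨-, h0, h1⟩ | ⟨-, h0, h1⟩) <;> linarith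
    rw [hempty]
    exact isPreconnected_empty
  · refine IsPreconnected.union !₂[0, 0, d / 2] ?_ ?_ (isPreconnected_circleCone_s7 zero_le_one)
      (isPreconnected_circleCone_s7 zero_le_one) <;>
    · refine ⟨?_, ?_, ?_⟩ <;> simp [hd]

lemma eq_zero_of_apply_eq_zero {p : EuclideanSpace ℝ (Fin 3)} (h0 : p 0 = 0) (h1 : p 1 = 0)
    (h2 : p 2 = 0) : p = 0 := by
  ext i
  fin_cases i <;> simp [h0, h1, h2]

lemma pos_of_sq_add_sq {a b c : ℝ} {p : EuclideanSpace ℝ (Fin 3)} (hp : p ≠ 0)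
    (h : (p 0 - a * p 2) ^ 2 + (p 1 - b * p 2) ^ 2 = c * p 2 ^ 2) (ht : 0 ≤ p 2) : 0 < p 2 := by
  refine lt_of_le_of_ne ht fun h2 ↦ hp ?_
  rw [← h2] at h
  refine eq_zero_of_apply_eq_zero ?_ ?_ h2.symm <;> nlinarith [sq_nonneg (p 0), sq_nonneg (p 1)]

lemma ConeW.mem_circleCone {p : EuclideanSpace ℝ (Fin 3)} {d : ℝ} (hp : p ∈ ConeW)
    (h0 : p ≠ 0) (hd : p 2 < d) : p ∈ CircleCone 1 1 d ∪ CircleCone (-1) 1 d := by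
  obtain ⟨h, ht⟩ := hp
  rcases mul_eq_zero.mp h with h | h
  · exact .inl ⟨by linarith, pos_of_sq_add_sq (a := 1) (b := 0) (c := 1) h0 (by linarith) ht, hd⟩
  · exact .inr ⟨by linarith, pos_of_sq_add_sq (a := -1) (b := 0) (c := 1) h0 (by linarith) ht, hd⟩

lemma circleCone_union_subset_coneW {d : ℝ} :
    CircleCone 1 1 d ∪ CircleCone (-1) 1 d ⊆ ConeW := by
  rintro p (⟨h, h0, -⟩ | ⟨h, h0, -⟩)
  · exact ⟨mul_eq_zero_of_left (by linarith) _, h0.le⟩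
  · exact ⟨mul_eq_zero_of_right _ (by linarith), h0.le⟩

lemma circleCone_ne_zero {a b d : ℝ} {p : EuclideanSpace ℝ (Fin 3)}
    (hp : p ∈ CircleCone a b d) : p ≠ 0 := by
  rintro rfl
  exact lt_irrefl (0 : ℝ) (by simpa using hp.2.1)

/-- Near the apex, two points of the same piece of `C₂` lie in a connected subset of `C₂ \ {0}`. -/
lemma exists_isPreconnected_of_mem_piece {d : ℝ} {S : Set (EuclideanSpace ℝ (Fin 3))}
    (hS : S = ConeW ∨ S = PieceV2 ∨ S = PieceV3) :
    ∃ K ⊆ S, IsPreconnected K ∧ K ⊆ ball 0 (3 * d) ∧ (0 : EuclideanSpace ℝ (Fin 3)) ∉ K ∧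
      ∀ p ∈ S, p ≠ 0 → p 2 < d → p ∈ K := by
  rcases hS with rfl | rfl | rfl
  · refine ⟨_, circleCone_union_subset_coneW (d := d), isPreconnected_circleCone_union,
      union_subset (CircleCone.subset_ball (by simp) zero_le_one le_rfl)
        (CircleCone.subset_ball (by simp) zero_le_one le_rfl), ?_,
      fun p hp h0 hd ↦ ConeW.mem_circleCone hp h0 hd⟩
    rintro (h | h) <;> exact circleCone_ne_zero h rfl
  · refine ⟨CircleCone 1 (1 / 4) d, fun p hp ↦ ⟨by linarith [hp.1], hp.2.1.le⟩,
      isPreconnected_circleCone_s7 (by norm_num),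
      CircleCone.subset_ball (by simp) (by norm_num) (by norm_num),
      fun h ↦ circleCone_ne_zero h rfl, fun p hp h0 hd ↦ ⟨by linarith [hp.1],
        pos_of_sq_add_sq (a := 1) (b := 0) (c := 1 / 16) h0 (by linarith [hp.1]) hp.2, hd⟩⟩
  · refine ⟨CircleCone (-1) (1 / 4) d, fun p hp ↦ ⟨by linarith [hp.1], hp.2.1.le⟩,
      isPreconnected_circleCone_s7 (by norm_num),
      CircleCone.subset_ball (by simp) (by norm_num) (by norm_num),
      fun h ↦ circleCone_ne_zero h rfl, fun p hp h0 hd ↦ ⟨by linarith [hp.1],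
        pos_of_sq_add_sq (a := -1) (b := 0) (c := 1 / 16) h0 (by linarith [hp.1]) hp.2, hd⟩⟩

lemma ConeW.pos {p : EuclideanSpace ℝ (Fin 3)} (hp : p ∈ ConeW) (h0 : p ≠ 0) : 0 < p 2 := by
  rcases ConeW.mem_circleCone hp h0 (lt_add_one (p 2)) with h | h <;> exact h.2.1

lemma ConeW.lt_sq_add_sq {p : EuclideanSpace ℝ (Fin 3)} (hp : p ∈ ConeW) (h0 : p ≠ 0) {s : ℝ}
    (hs : |s| = 1) : p 2 ^ 2 / 9 < (p 0 - p 2) ^ 2 + (p 1 - s * p 2 / 2) ^ 2 := by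
  have ht := ConeW.pos hp h0
  rcases mul_eq_zero.mp hp.1 with h | h
  · have hy : |p 1| ≤ p 2 := abs_le_of_sq_le_sq (by nlinarith [sq_nonneg (p 0 - p 2)]) ht.le
    rw [abs_le] at hy
    rcases (abs_eq zero_le_one).mp hs with rfl | rfl <;> nlinarith
  · have hx : p 0 ≤ 0 := by nlinarith [sq_nonneg (p 0), sq_nonneg (p 1)]
    nlinarith [sq_nonneg (p 1 - s * p 2 / 2)]

/-- A connected subset of `C₁ \ {0}` that meets one of the two small cones lies near that cone. -/
lemma subset_of_mem_small_cone {T : Set (EuclideanSpace ℝ (Fin 3))} (hT : IsPreconnected T)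
    (hTC : T ⊆ (ConeW ∪ PieceU2 ∪ PieceU3) \ {0}) {s : ℝ} (hs : |s| = 1)
    {p : EuclideanSpace ℝ (Fin 3)} (hp : p ∈ T)
    (hpS : (p 0 - p 2) ^ 2 + (p 1 - s * p 2 / 2) ^ 2 = p 2 ^ 2 / 16) (hpt : 0 < p 2) :
    ∀ q ∈ T, (q 0 - q 2) ^ 2 + (q 1 - s * q 2 / 2) ^ 2 < q 2 ^ 2 / 9 := by
  refine hT.subset_left_of_subset_union
    (u := {q | (q 0 - q 2) ^ 2 + (q 1 - s * q 2 / 2) ^ 2 < q 2 ^ 2 / 9})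
    (v := {q | q 2 ^ 2 / 9 < (q 0 - q 2) ^ 2 + (q 1 - s * q 2 / 2) ^ 2})
    (isOpen_lt (by fun_prop) (by fun_prop)) (isOpen_lt (by fun_prop) (by fun_prop))
    (disjoint_left.mpr fun q h1 h2 ↦ lt_asymm h1 h2) ?_ ⟨p, hp, ?_⟩
  · intro q hq
    obtain ⟨(hW | h2) | h3, h0⟩ := hTC hq
    · exact .inr (ConeW.lt_sq_add_sq hW h0 hs)
    · have ht := pos_of_sq_add_sq (a := 1) (b := 1 / 2) (c := 1 / 16) h0 (by linarith [h2.1]) h2.2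
      have he := h2.1
      have hy : q 1 ≥ q 2 / 4 := by nlinarith [sq_nonneg (q 0 - q 2)]
      rcases (abs_eq zero_le_one).mp hs with rfl | rfl
      · left; rw [mem_ofPred_eq]; nlinarith
      · right; rw [mem_ofPred_eq]; nlinarith
    · have ht := pos_of_sq_add_sq (a := 1) (b := -1 / 2) (c := 1 / 16) h0 (by linarith [h3.1]) h3.2
      have he := h3.1
      have hy : q 1 ≤ -(q 2 / 4) := by nlinarith [sq_nonneg (q 0 - q 2)]
      rcases (abs_eq zero_le_one).mp hs with rfl | rfl
      · right; rw [mem_ofPred_eq]; nlinarith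
      · left; rw [mem_ofPred_eq]; nlinarith
  · rw [mem_ofPred_eq]
    nlinarith

/-- A connected subset of the complement of `ConeW` adherent to a point inside one of the two
circular cones of `ConeW` lies inside that cone. -/
lemma subset_inside_of_mem_closure {T : Set (EuclideanSpace ℝ (Fin 3))} (hT : IsPreconnected T)
    (hTC : Disjoint T ConeW) {s : ℝ} (hs : |s| = 1) {p : EuclideanSpace ℝ (Fin 3)}
    (hp : p ∈ closure T) (hpS : (p 0 - s * p 2) ^ 2 + p 1 ^ 2 < p 2 ^ 2) (hpt : 0 < p 2) :
    ∀ q ∈ T, (q 0 - s * q 2) ^ 2 + q 1 ^ 2 < q 2 ^ 2 ∧ 0 < q 2 := by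
  have hu : IsOpen ({q : EuclideanSpace ℝ (Fin 3) |
      (q 0 - s * q 2) ^ 2 + q 1 ^ 2 < q 2 ^ 2} ∩ {q | 0 < q 2}) :=
    (isOpen_lt (by fun_prop) (by fun_prop)).inter (isOpen_lt (by fun_prop) (by fun_prop))
  have hv : IsOpen ({q : EuclideanSpace ℝ (Fin 3) |
      q 2 ^ 2 < (q 0 - s * q 2) ^ 2 + q 1 ^ 2} ∪ {q | q 2 < 0}) :=
    (isOpen_lt (by fun_prop) (by fun_prop)).union (isOpen_lt (by fun_prop) (by fun_prop))
  refine fun q hq ↦ (hT.subset_left_of_subset_union hu hv (disjoint_left.mpr ?_) ?_ ?_) hq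
  · rintro q ⟨h1, h2⟩ (h3 | h3) <;> rw [mem_ofPred_eq] at * <;> linarith
  · intro q hq
    by_contra hcon
    simp only [mem_union, mem_inter_iff, mem_ofPred_eq, not_or, not_and, not_lt] at hcon
    obtain ⟨h1, h2, h3⟩ := hcon
    refine disjoint_left.mp hTC hq ⟨?_, h3⟩
    have he : (q 0 - s * q 2) ^ 2 + q 1 ^ 2 = q 2 ^ 2 := by
      refine le_antisymm h2 (not_lt.mp fun h ↦ ?_)
      have h4 : q 2 = 0 := le_antisymm (h1 h) h3
      rw [h4] at h
      nlinarith [sq_nonneg (q 0 - s * 0), sq_nonneg (q 1)]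
    rcases (abs_eq zero_le_one).mp hs with rfl | rfl
    · exact mul_eq_zero_of_left (by linarith) _
    · exact mul_eq_zero_of_right _ (by linarith)
  · obtain ⟨q, hq, hqT⟩ := mem_closure_iff.mp hp _ hu ⟨hpS, hpt⟩
    exact ⟨q, hqT, hq⟩

/-- No component of the complement of `C₂` is adherent to both small cones away from `0`. -/
lemma not_mem_closure_of_mem_pieceV {T : Set (EuclideanSpace ℝ (Fin 3))} (hT : IsPreconnected T)
    (hTC : Disjoint T ConeW) {p q : EuclideanSpace ℝ (Fin 3)} (hp : p ∈ PieceV2) (hp0 : p ≠ 0)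
    (hpT : p ∈ closure T) (hq : q ∈ PieceV3) (hq0 : q ≠ 0) : q ∉ closure T := by
  intro hqT
  have hpt := pos_of_sq_add_sq (a := 1) (b := 0) (c := 1 / 16) hp0 (by linarith [hp.1]) hp.2
  have hqt := pos_of_sq_add_sq (a := -1) (b := 0) (c := 1 / 16) hq0 (by linarith [hq.1]) hq.2
  have h1 := subset_inside_of_mem_closure hT hTC (s := 1) (by simp) hpT
    (by nlinarith [hp.1]) hpt
  have h2 := subset_inside_of_mem_closure hT hTC (s := -1) (by simp) hqT
    (by nlinarith [hq.1]) hqt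
  obtain ⟨z, hz⟩ := closure_nonempty_iff.mp ⟨p, hpT⟩
  obtain ⟨ha, ht⟩ := h1 z hz
  obtain ⟨hb, -⟩ := h2 z hz
  nlinarith [sq_nonneg (z 0), sq_nonneg (z 1)]

/-- An open triangle (with part of one side) at height `e` in the complement of `C₁`; its vertices
lie on the three pieces of `C₁`. -/
def Triangle (e : ℝ) : Set (EuclideanSpace ℝ (Fin 3)) :=
  {p | p 2 = e ∧ e ≤ p 0 ∧ p 0 + 4 * p 1 < 2 * e ∧ p 0 - 4 * p 1 < 2 * e}

lemma convex_triangle (e : ℝ) : Convex ℝ (Triangle e) := by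
  rintro p ⟨h1, h2, h3, h4⟩ q ⟨k1, k2, k3, k4⟩ a b ha hb hab
  obtain rfl : b = 1 - a := by linarith
  refine ⟨?_, ?_, ?_, ?_⟩ <;> simp only [PiLp.add_apply, PiLp.smul_apply, smul_eq_mul]
  · rw [h1, k1]; ring
  · nlinarith
  · rcases ha.eq_or_lt with rfl | ha <;> nlinarith
  · rcases ha.eq_or_lt with rfl | ha <;> nlinarith

lemma triangle_disjoint (e : ℝ) : Disjoint (Triangle e) (ConeW ∪ PieceU2 ∪ PieceU3) := by
  refine disjoint_left.mpr ?_
  rintro p ⟨rfl, h2, h3, h4⟩ ((h | h) | h)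
  · rcases mul_eq_zero.mp h.1 with h | h
    · have hpos : 0 < 2 * p 2 - p 0 := by linarith
      have hy : p 1 ^ 2 ≤ ((2 * p 2 - p 0) / 4) ^ 2 := sq_le_sq' (by linarith) (by linarith)
      nlinarith
    · nlinarith [sq_nonneg (p 1)]
  · have := h.1
    nlinarith [h.2, sq_nonneg (p 0 - p 2)]
  · have := h.1
    nlinarith [h.2, sq_nonneg (p 0 - p 2)]

lemma triangle_subset_ball {e : ℝ} (he : 0 < e) : Triangle e ⊆ ball 0 (4 * e) := by
  rintro p ⟨rfl, h2, h3, h4⟩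
  rw [mem_ball_zero_iff]
  refine (norm_le_three_mul ?_ ?_).trans_lt (by linarith) <;>
    rw [abs_le] <;> constructor <;> linarith

lemma mem_closure_triangle {e x y : ℝ} (he : 0 < e) (hx : e ≤ x) (h1 : x + 4 * y ≤ 2 * e)
    (h2 : x - 4 * y ≤ 2 * e) : !₂[x, y, e] ∈ closure (Triangle e) := by
  refine closure_mono ?_ (closure_openSegment (𝕜 := ℝ) !₂[e, 0, e] !₂[x, y, e] ▸
    right_mem_segment ℝ !₂[e, 0, e] !₂[x, y, e])
  rintro _ ⟨a, b, ha, hb, hab, rfl⟩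
  obtain rfl : b = 1 - a := by linarith
  refine ⟨?_, ?_, ?_, ?_⟩ <;> simp <;> nlinarith

/-- the germs at `0` of the tangent cones `C₁ = W ∪ U₂ ∪ U₃` and
`C₂ = W ∪ V₂ ∪ V₃` of the surfaces of Example 1 are NOT ambient topologically equivalent. -/
theorem example1_tangentCones_not_ambient_top_equiv :
    ¬ AmbientTopEquiv (ConeW ∪ PieceU2 ∪ PieceU3) (ConeW ∪ PieceV2 ∪ PieceV3) := by
  rintro ⟨U, V, hU, hV, h0U, h0V, h, g, hh, hg, hUV, hVU, hgh, -, h0, him⟩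
  obtain ⟨ρ, hρ, hρV⟩ := Metric.isOpen_iff.mp hV 0 h0V
  obtain ⟨r, hr, hrU⟩ := Metric.mem_nhds_iff.mp (Filter.inter_mem (hU.mem_nhds h0U)
    ((hh.continuousAt (hU.mem_nhds h0U)).preimage_mem_nhds
      (h0 ▸ ball_mem_nhds (0 : EuclideanSpace ℝ (Fin 3)) (show 0 < ρ / 3 by positivity))))
  have he : 0 < r / 5 := by positivity
  set e := r / 5 with he_def
  have hQr : closure (Triangle e) ⊆ ball 0 r := by
    refine (closure_mono (triangle_subset_ball he)).trans (closure_ball_subset_closedBall.trans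
      (closedBall_subset_ball (by linarith)))
  set T := h '' Triangle e
  have hQU : Triangle e ⊆ U := fun p hp ↦ (hrU (hQr (subset_closure hp))).1
  have hT : IsPreconnected T := (convex_triangle e).isPreconnected.image h (hh.mono hQU)
  have hTW : Disjoint T ConeW := by
    refine disjoint_left.mpr ?_
    rintro _ ⟨p, hp, rfl⟩ hW
    obtain ⟨c, ⟨hc, hcU⟩, hcp⟩ : h p ∈ h '' ((ConeW ∪ PieceU2 ∪ PieceU3) ∩ U) :=
      him ▸ ⟨.inl (.inl hW), hUV (hQU hp)⟩
    have hcp' : c = p := by rw [← hgh c hcU, hcp, hgh p (hQU hp)]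
    exact disjoint_left.mp (triangle_disjoint e) hp (hcp' ▸ hc)
  have hvertex : ∀ p ∈ closure (Triangle e), p ∈ ConeW ∪ PieceU2 ∪ PieceU3 → p ≠ 0 →
      h p ∈ closure T ∧ h p ∈ ConeW ∪ PieceV2 ∪ PieceV3 ∧ h p ≠ 0 ∧ h p 2 < ρ / 3 ∧
        g (h p) = p := by
    intro p hp hpC hp0
    obtain ⟨hpU, hpρ⟩ := hrU (hQr hp)
    rw [mem_preimage, h0] at hpρ
    refine ⟨((hh p hpU).mono hQU).mem_closure_image hp, ?_, fun hz ↦ hp0 ?_, ?_, hgh p hpU⟩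
    · exact (him ▸ mem_image_of_mem h ⟨hpC, hpU⟩ : h p ∈ (ConeW ∪ PieceV2 ∪ PieceV3) ∩ V).1
    · have hg0 := hgh 0 h0U
      rw [h0] at hg0
      rw [← hgh p hpU, hz, hg0]
    · exact (le_abs_self _).trans_lt
        ((PiLp.norm_apply_le (h p) 2).trans_lt (mem_ball_zero_iff.mp hpρ))
  have hpull : ∀ S : Set (EuclideanSpace ℝ (Fin 3)), S = ConeW ∨ S = PieceV2 ∨ S = PieceV3 →
      ∀ p q, p ≠ 0 → q ≠ 0 → p ∈ S → q ∈ S → p 2 < ρ / 3 → q 2 < ρ / 3 →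
      ∃ K, IsPreconnected K ∧ K ⊆ (ConeW ∪ PieceU2 ∪ PieceU3) \ {0} ∧ g p ∈ K ∧ g q ∈ K := by
    intro S hS p q hp0 hq0 hp hq hpd hqd
    obtain ⟨K, hKS, hK, hKρ, hK0, hKmem⟩ := exists_isPreconnected_of_mem_piece (d := ρ / 3) hS
    have hKV : K ⊆ V := fun z hz ↦ hρV (by simpa [mul_div_cancel₀] using hKρ hz)
    refine ⟨g '' K, hK.image g (hg.mono hKV), ?_, mem_image_of_mem g (hKmem p hp hp0 hpd),
      mem_image_of_mem g (hKmem q hq hq0 hqd)⟩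
    rintro _ ⟨z, hz, rfl⟩
    have hzC : z ∈ ConeW ∪ PieceV2 ∪ PieceV3 := by
      rcases hS with rfl | rfl | rfl
      · exact .inl (.inl (hKS hz))
      · exact .inl (.inr (hKS hz))
      · exact .inr (hKS hz)
    obtain ⟨c, ⟨hc, hcU⟩, rfl⟩ : z ∈ h '' ((ConeW ∪ PieceU2 ∪ PieceU3) ∩ U) :=
      him ▸ ⟨hzC, hKV hz⟩
    rw [hgh c hcU]
    refine ⟨hc, ?_⟩
    rintro rfl
    exact hK0 (h0 ▸ hz)
  have hne : ∀ x y : ℝ, !₂[x, y, e] ≠ (0 : EuclideanSpace ℝ (Fin 3)) := fun x y hz ↦ by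
    have := congrArg (fun p : EuclideanSpace ℝ (Fin 3) ↦ p 2) hz
    simp at this
    linarith
  obtain ⟨a1, a2, a3, a4, a5⟩ := hvertex !₂[2 * e, 0, e]
    (mem_closure_triangle he (by linarith) (by linarith) (by linarith))
    (.inl (.inl ⟨by simp; left; ring, by simpa using he.le⟩)) (hne _ _)
  obtain ⟨b1, b2, b3, b4, b5⟩ := hvertex !₂[e, e / 4, e]
    (mem_closure_triangle he (by linarith) (by linarith) (by linarith))
    (.inl (.inr ⟨by simp; ring, by simpa using he.le⟩)) (hne _ _)
  obtain ⟨c1, c2, c3, c4, c5⟩ := hvertex !₂[e, -(e / 4), e]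
    (mem_closure_triangle he (by linarith) (by linarith) (by linarith))
    (.inr ⟨by simp; ring, by simpa using he.le⟩) (hne _ _)
  have hab : ∀ S : Set (EuclideanSpace ℝ (Fin 3)), S = ConeW ∨ S = PieceV2 ∨ S = PieceV3 →
      h !₂[e, e / 4, e] ∈ S → h !₂[2 * e, 0, e] ∉ S := by
    intro S hS hb ha
    obtain ⟨K, hK, hKC, hbK, haK⟩ := hpull S hS _ _ b3 a3 hb ha b4 a4
    rw [b5] at hbK
    rw [a5] at haK
    have := subset_of_mem_small_cone hK hKC (s := 1) (by simp) hbK (by simp; ring)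
      (by simpa using he) _ haK
    simp at this
    nlinarith
  have hac : ∀ S : Set (EuclideanSpace ℝ (Fin 3)), S = ConeW ∨ S = PieceV2 ∨ S = PieceV3 →
      h !₂[e, -(e / 4), e] ∈ S → h !₂[2 * e, 0, e] ∉ S := by
    intro S hS hc ha
    obtain ⟨K, hK, hKC, hcK, haK⟩ := hpull S hS _ _ c3 a3 hc ha c4 a4
    rw [c5] at hcK
    rw [a5] at haK
    have := subset_of_mem_small_cone hK hKC (s := -1) (by simp) hcK (by simp; ring)
      (by simpa using he) _ haK
    simp at this
    nlinarith
  have hbc : ∀ S : Set (EuclideanSpace ℝ (Fin 3)), S = ConeW ∨ S = PieceV2 ∨ S = PieceV3 →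
      h !₂[e, e / 4, e] ∈ S → h !₂[e, -(e / 4), e] ∉ S := by
    intro S hS hb hc
    obtain ⟨K, hK, hKC, hbK, hcK⟩ := hpull S hS _ _ b3 c3 hb hc b4 c4
    rw [b5] at hbK
    rw [c5] at hcK
    have := subset_of_mem_small_cone hK hKC (s := 1) (by simp) hbK (by simp; ring)
      (by simpa using he) _ hcK
    simp at this
    nlinarith
  have hsep : ∀ p q, p ∈ closure T → q ∈ closure T → p ≠ 0 → q ≠ 0 → p ∈ PieceV2 →
      q ∉ PieceV3 := fun p q hp hq hp0 hq0 hp2 hq3 ↦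
    not_mem_closure_of_mem_pieceV hT hTW hp2 hp0 hp hq3 hq0 hq
  rcases a2 with (a | a) | a <;> rcases b2 with (b | b) | b <;> rcases c2 with (c | c) | c <;>
  first
  | exact hab _ (by simp) b a
  | exact hac _ (by simp) c a
  | exact hbc _ (by simp) b c
  | exact hsep _ _ a1 b1 a3 b3 a b
  | exact hsep _ _ a1 c1 a3 c3 a c
  | exact hsep _ _ b1 a1 b3 a3 b a
  | exact hsep _ _ b1 c1 b3 c3 b c
  | exact hsep _ _ c1 a1 c3 a3 c a
  | exact hsep _ _ c1 b1 c3 b3 c b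
end
end
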